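/- arXiv:math/0505546 — 3 statements merged into one kernel-verified Lean document; each statement's English description precedes it below -/
import Mathlib

section
/- Let R be a polynomial with real coefficients of degree N ≥ 2 such that R(0) = 0, c := R'(0) > 1, and there exists a > 0 with the property that every complex number z with R(z) ∈ [0,a] satisfies z ∈ [0,a]. Fix z₀ ∈ [0,a] and set d_R := 2·log N / log c. Then ζ_{z₀,R} extends to a function F meromorphic on the half-plane {s : Re(s) > 0} such that F is holomorphic at every point of {s : Re(s) > 0} that does not belong to the set {d_R + 4πik/log c : k ∈ ℤ}; that is, all poles of the meromorphic continuation of ζ_{z₀,R} to Re(s) > 0 are contained in the arithmetic progression {d_R + 4πik/log c : k ∈ ℤ}. -/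
open Polynomial Filter Complex

/-- The `n`-fold composition `R^{∘n}` of a polynomial, with `R^{∘0} = X`. -/
noncomputable def polyIter (R : Polynomial ℝ) : ℕ → Polynomial ℝ
  | 0 => Polynomial.X
  | n + 1 => R.comp (polyIter R n)

/-- The multiset `R^{-n}{z₀}` of complex roots (with multiplicity) of `R^{∘n}(z) - z₀`. -/
noncomputable def preimageRoots (R : Polynomial ℝ) (z₀ : ℝ) (n : ℕ) : Multiset ℂ :=
  ((polyIter R n - Polynomial.C z₀).map (algebraMap ℝ ℂ)).roots

/-- The partial sum `Σ_{z ∈ R^{-n}{z₀}, z ≠ 0} (cⁿ z)^{-s/2}`. -/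
noncomputable def zetaPartial (R : Polynomial ℝ) (c z₀ : ℝ) (n : ℕ) (s : ℂ) : ℂ :=
  ((preimageRoots R z₀ n).map
    (fun z => if z = 0 then 0 else ((c : ℂ) ^ n * z) ^ (-s / 2))).sum

/-- Membership of a complex number in the real interval `[0, a]`. -/
def memIcc (a : ℝ) (z : ℂ) : Prop := z.im = 0 ∧ z.re ∈ Set.Icc 0 a

theorem continuous_of_isClosed_graph_of_compactSpace {X K : Type*} [TopologicalSpace X]
    [TopologicalSpace K] [CompactSpace K] {f : X → K}
    (hf : IsClosed {p : X × K | f p.1 = p.2}) : Continuous f := by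
  refine continuous_iff_isClosed.2 fun s hs => ?_
  have h := isClosedMap_fst_of_compactSpace _ (hf.inter (hs.preimage continuous_snd))
  convert h using 1
  ext x
  simp

/-- `φ` is the system of ordered continuous inverse branches of `R` over `[0, a]`. -/
structure IsBranchSystem (R : Polynomial ℝ) (a : ℝ) {N : ℕ}
    (φ : Fin N → Set.Icc 0 a → Set.Icc 0 a) : Prop where
  continuous : ∀ j, Continuous (φ j)
  mono : ∀ x : Set.Icc 0 a, Monotone fun j => φ j x
  factor : ∀ x : Set.Icc 0 a, R - C (x : ℝ) = C R.leadingCoeff * ∏ j, (X - C (φ j x : ℝ))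

theorem eq_of_monotone_of_prod_X_sub_C_eq {N : ℕ} {p q : Fin N → ℝ} (hp : Monotone p)
    (hq : Monotone q) (h : ∏ j, (X - C (p j)) = ∏ j, (X - C (q j))) : p = q := by
  have h1 : ∀ r : Fin N → ℝ, (∏ j, (X - C (r j))).roots = (List.ofFn r : Multiset ℝ) := by
    intro r
    rw [← Fin.univ_val_map, ← Polynomial.roots_multiset_prod_X_sub_C (Finset.univ.val.map r),
      Multiset.map_map]
    rfl
  have h2 : (List.ofFn p).Perm (List.ofFn q) := by
    rw [← Multiset.coe_eq_coe, ← h1, ← h1, h]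
  exact List.ofFn_injective (h2.eq_of_sortedLE hp.sortedLE_ofFn hq.sortedLE_ofFn)

theorem exists_monotone_factorization {R : Polynomial ℝ} {a : ℝ} {N : ℕ} (hN : R.natDegree = N)
    (hpos : 0 < N) (hinv : ∀ z : ℂ, memIcc a (Polynomial.aeval z R) → memIcc a z)
    (x : Set.Icc 0 a) :
    ∃ p : Fin N → Set.Icc 0 a, Monotone p ∧
      R - C (x : ℝ) = C R.leadingCoeff * ∏ j, (X - C (p j : ℝ)) := by
  have hdeg : (R - C (x : ℝ)).natDegree = N := by rw [natDegree_sub_C, hN]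
  have hlead : (R - C (x : ℝ)).leadingCoeff = R.leadingCoeff := by
    apply leadingCoeff_sub_of_degree_lt
    exact degree_C_le.trans_lt (natDegree_pos_iff_degree_pos.1 (hN ▸ hpos))
  have hmem : ∀ z : ℂ, Polynomial.aeval z (R - C (x : ℝ)) = 0 → memIcc a z := by
    intro z hz
    apply hinv
    rw [map_sub, sub_eq_zero] at hz
    rw [hz]
    simp [memIcc]
  have hsplit : (R - C (x : ℝ)).Splits := by
    refine Splits.of_splits_map_of_injective (algebraMap ℝ ℂ).injective
      (IsAlgClosed.splits _) fun z hz => ?_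
    have hz' := hmem z (by
      have := (mem_roots'.1 hz).2
      rwa [IsRoot, eval_map_algebraMap] at this)
    exact ⟨z.re, Complex.ext (by simp) (by simp [hz'.1])⟩
  set l := (R - C (x : ℝ)).roots.toList with hl
  have hlen : l.length = N := by
    rw [hl, Multiset.length_toList, ← hsplit.natDegree_eq_card_roots, hdeg]
  have hlmem : ∀ r ∈ l, r ∈ Set.Icc 0 a := by
    intro r hr
    rw [hl, Multiset.mem_toList] at hr
    have h0 : (R - C (x : ℝ)).eval r = 0 := (mem_roots'.1 hr).2
    have := hmem (r : ℂ) (by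
      have h3 := aeval_algebraMap_apply_eq_algebraMap_eval (A := ℂ) r (R - C (x : ℝ))
      rw [h0] at h3
      simpa using h3)
    simpa using this.2
  subst hlen
  let q : Fin l.length → Set.Icc 0 a := fun i => ⟨l.get i, hlmem _ (List.get_mem _ _)⟩
  refine ⟨q ∘ Tuple.sort q, Tuple.monotone_sort q, ?_⟩
  have h1 : ∏ j, (X - C ((q ∘ Tuple.sort q) j : ℝ)) = ∏ j, (X - C (q j : ℝ)) :=
    Equiv.prod_comp (Tuple.sort q) fun j => (X - C (q j : ℝ))
  rw [h1]
  conv_lhs => rw [hsplit.eq_prod_roots, hlead, ← Multiset.coe_toList (R - C (x : ℝ)).roots]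
  congr 1
  rw [Multiset.map_coe, Multiset.prod_coe, ← hl, ← Fin.prod_univ_fun_getElem]
  rfl

theorem exists_isBranchSystem {R : Polynomial ℝ} {a : ℝ} {N : ℕ} (hN : R.natDegree = N)
    (hpos : 0 < N) (hinv : ∀ z : ℂ, memIcc a (Polynomial.aeval z R) → memIcc a z) :
    ∃ φ : Fin N → Set.Icc 0 a → Set.Icc 0 a, IsBranchSystem R a φ := by
  choose p hp hfac using exists_monotone_factorization hN hpos hinv
  have hlead : R.leadingCoeff ≠ 0 := by
    rw [Ne, leadingCoeff_eq_zero]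
    rintro rfl
    simp at hN
    omega
  have hcont : Continuous p := by
    apply continuous_of_isClosed_graph_of_compactSpace
    have hset : {y : Set.Icc 0 a × (Fin N → Set.Icc 0 a) | p y.1 = y.2} =
        {y | ∀ i j : Fin N, i ≤ j → (y.2 i : ℝ) ≤ y.2 j} ∩
        {y | ∀ t : ℝ, R.eval t - y.1 = R.leadingCoeff * ∏ j, (t - (y.2 j : ℝ))} := by
      ext ⟨x, q⟩
      simp only [Set.mem_ofPred_eq, Set.mem_inter_iff]
      constructor
      · rintro rfl
        refine ⟨fun i j hij => hp x hij, fun t => ?_⟩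
        have := congrArg (Polynomial.eval t) (hfac x)
        simpa [eval_prod] using this
      · rintro ⟨h1, h2⟩
        have h3 : R - C (x : ℝ) = C R.leadingCoeff * ∏ j, (X - C (q j : ℝ)) := by
          apply Polynomial.funext
          intro t
          simpa [eval_prod] using h2 t
        rw [hfac x] at h3
        have h4 := eq_of_monotone_of_prod_X_sub_C_eq (p := fun j => (p x j : ℝ))
          (q := fun j => (q j : ℝ)) (fun i j hij => hp x hij) h1
          (mul_left_cancel₀ (by simpa using hlead) h3)
        funext j
        exact Subtype.ext (congrFun h4 j)
    rw [hset]
    refine IsClosed.inter ?_ ?_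
    · simp only [Set.ofPred_forall]
      refine isClosed_iInter fun i => isClosed_iInter fun j => isClosed_iInter fun _ => ?_
      exact isClosed_le (by fun_prop) (by fun_prop)
    · simp only [Set.ofPred_forall]
      refine isClosed_iInter fun t => ?_
      exact isClosed_eq (by fun_prop) (by fun_prop)
  exact ⟨fun j x => p x j, fun j => (continuous_apply j).comp hcont, hp, hfac⟩

namespace IsBranchSystem

variable {R : Polynomial ℝ} {a : ℝ} {N : ℕ} {φ : Fin N → Set.Icc 0 a → Set.Icc 0 a}

theorem eval_branch (h : IsBranchSystem R a φ) (j : Fin N) (x : Set.Icc 0 a) :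
    R.eval (φ j x : ℝ) = x := by
  have := congrArg (Polynomial.eval (φ j x : ℝ)) (h.factor x)
  rw [eval_mul, eval_prod, Finset.prod_eq_zero (Finset.mem_univ j) (by simp)] at this
  simpa [sub_eq_zero] using this

theorem injective (h : IsBranchSystem R a φ) (j : Fin N) : Function.Injective (φ j) := by
  intro x y hxy
  apply Subtype.ext
  rw [← h.eval_branch j x, ← h.eval_branch j y, hxy]

theorem monotone_or_antitone (h : IsBranchSystem R a φ) (ha : 0 ≤ a) (j : Fin N) :
    Monotone (φ j) ∨ Antitone (φ j) := by
  have hc : ContinuousOn (Set.IccExtend ha (φ j)) (Set.Icc 0 a) :=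
    (h.continuous j).Icc_extend'.continuousOn
  have hi : Set.InjOn (Set.IccExtend ha (φ j)) (Set.Icc 0 a) := by
    intro x hx y hy hxy
    rw [Set.IccExtend_of_mem _ _ hx, Set.IccExtend_of_mem _ _ hy] at hxy
    exact congrArg Subtype.val (h.injective j hxy)
  refine (hc.strictMonoOn_of_injOn_Icc' ha hi).imp (fun H x y hxy => ?_) fun H x y hxy => ?_
  · have := H.monotoneOn x.2 y.2 hxy
    rwa [Set.IccExtend_val, Set.IccExtend_val] at this
  · have := H.antitoneOn x.2 y.2 hxy
    rwa [Set.IccExtend_val, Set.IccExtend_val] at this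

theorem derivative_eval_eq_zero (h : IsBranchSystem R a φ) {i j : Fin N} (hij : i ≠ j)
    {x : Set.Icc 0 a} (hx : φ i x = φ j x) : R.derivative.eval (φ i x : ℝ) = 0 := by
  have h1 : R - C (x : ℝ) = (X - C (φ i x : ℝ)) * ((X - C (φ i x : ℝ)) *
      (C R.leadingCoeff * ∏ k ∈ (Finset.univ.erase i).erase j, (X - C (φ k x : ℝ)))) := by
    rw [h.factor x, ← Finset.mul_prod_erase Finset.univ _ (Finset.mem_univ i),
      ← Finset.mul_prod_erase (Finset.univ.erase i) _
        (Finset.mem_erase.2 ⟨hij.symm, Finset.mem_univ j⟩), ← hx]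
    ring
  have h2 : R.derivative = (R - C (x : ℝ)).derivative := by simp
  rw [h2, h1]
  simp

theorem branch_le_branch (h : IsBranchSystem R a φ) (hR : R.derivative ≠ 0) {i j : Fin N}
    (hij : i < j) (x y : Set.Icc 0 a) : φ i x ≤ φ j y := by
  by_contra! hlt
  have : PreconnectedSpace (Set.Icc 0 a) := Subtype.preconnectedSpace isPreconnected_Icc
  refine hR (eq_zero_of_infinite_isRoot _ ((Set.Icc_infinite
    (show (φ j y : ℝ) < φ i x from hlt)).mono fun q hq => ?_))
  let q' : Set.Icc 0 a := ⟨q, (φ j y).2.1.trans hq.1, hq.2.trans (φ i x).2.2⟩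
  obtain ⟨t, ht⟩ := mem_range_of_exists_le_of_exists_ge (c := q') (h.continuous i)
    ⟨y, (h.mono y hij.le).trans hq.1⟩ ⟨x, hq.2⟩
  obtain ⟨t', ht'⟩ := mem_range_of_exists_le_of_exists_ge (c := q') (h.continuous j)
    ⟨y, hq.1⟩ ⟨x, le_trans (show q' ≤ φ i x from hq.2) (h.mono x hij.le)⟩
  have htt : t = t' := by
    apply Subtype.ext
    rw [← h.eval_branch i t, ← h.eval_branch j t', ht, ht']
  subst htt
  have := h.derivative_eval_eq_zero hij.ne (ht.trans ht'.symm)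
  rwa [ht] at this

end IsBranchSystem

namespace IsBranchSystem

variable {R : Polynomial ℝ} {a c : ℝ} {M : ℕ} {φ : Fin (M + 2) → Set.Icc 0 a → Set.Icc 0 a}

theorem branch_zero_zero (h : IsBranchSystem R a φ) (ha : 0 ≤ a) (hR0 : R.eval 0 = 0)
    (hR : R ≠ 0) : φ 0 ⟨0, le_rfl, ha⟩ = ⟨0, le_rfl, ha⟩ := by
  have h1 := congrArg (Polynomial.eval 0) (h.factor ⟨0, le_rfl, ha⟩)
  simp only [map_zero, sub_zero, hR0, eval_mul, eval_C, eval_prod, eval_sub, eval_X, zero_sub] at h1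
  obtain ⟨j, -, hj⟩ := Finset.prod_eq_zero_iff.1
    ((mul_eq_zero.1 h1.symm).resolve_left (by simpa using hR))
  have h2 : φ 0 ⟨0, le_rfl, ha⟩ ≤ φ j ⟨0, le_rfl, ha⟩ := h.mono _ (Fin.zero_le j)
  refine le_antisymm (h2.trans (Subtype.coe_le_coe.1 ?_)) (φ 0 _).2.1
  simpa using (neg_eq_zero.1 hj).le

theorem branch_zero_monotone (h : IsBranchSystem R a φ) (ha : 0 < a) (hR0 : R.eval 0 = 0)
    (hR : R ≠ 0) : Monotone (φ 0) := by
  refine (h.monotone_or_antitone ha.le 0).resolve_right fun hanti => ?_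
  have h1 : φ 0 ⟨a, ha.le, le_rfl⟩ = φ 0 ⟨0, le_rfl, ha.le⟩ :=
    le_antisymm (hanti (Subtype.coe_le_coe.1 ha.le))
      ((h.branch_zero_zero ha.le hR0 hR).trans_le (φ 0 _).2.1)
  exact ha.ne' (congrArg Subtype.val (h.injective 0 h1))

theorem branch_zero_pos (h : IsBranchSystem R a φ) (hR0 : R.eval 0 = 0)
    (x : Set.Icc 0 a) (hx : (0 : ℝ) < x) : (0 : ℝ) < φ 0 x := by
  refine lt_of_le_of_ne (φ 0 x).2.1 fun h0 => hx.ne' ?_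
  rw [← h.eval_branch 0 x, ← h0, hR0]

theorem branch_zero_lt (h : IsBranchSystem R a φ) (ha : 0 < a) (hR : R.derivative ≠ 0) :
    (φ 0 ⟨a, ha.le, le_rfl⟩ : ℝ) < a := by
  refine lt_of_le_of_ne (φ 0 _).2.2 fun h0 => ha.ne ?_
  have h1 := h.branch_le_branch hR (show (0 : Fin (M + 2)) < 1 from Fin.zero_lt_one)
    ⟨a, ha.le, le_rfl⟩ ⟨0, le_rfl, ha.le⟩
  have h2 : (φ 1 ⟨0, le_rfl, ha.le⟩ : ℝ) = a :=
    le_antisymm (φ 1 _).2.2 (h0.symm.le.trans h1)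
  have h3 := h.eval_branch 1 ⟨0, le_rfl, ha.le⟩
  have h4 := h.eval_branch 0 ⟨a, ha.le, le_rfl⟩
  rw [h2] at h3
  rw [h0, h3] at h4
  exact h4

theorem exists_eq_X_mul (h : IsBranchSystem R a φ) (ha : 0 < a) (hR0 : R.eval 0 = 0)
    (hc : R.derivative.eval 0 = c) (hc0 : 0 < c) :
    ∃ Q : Polynomial ℝ, R = X * Q ∧ Q.eval 0 = c ∧
      AntitoneOn (fun y => Q.eval y) (Set.Icc 0 (φ 0 ⟨a, ha.le, le_rfl⟩ : ℝ)) := by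
  have hR : R.derivative ≠ 0 := by
    intro h0
    rw [h0] at hc
    simp at hc
    exact hc0.ne hc
  have hR' : R ≠ 0 := by rintro rfl; simp at hR
  set z : Set.Icc 0 a := ⟨0, le_rfl, ha.le⟩ with hz
  set Q : Polynomial ℝ := C R.leadingCoeff * ∏ j : Fin (M + 1), (X - C (φ j.succ z : ℝ)) with hQ
  have hRQ : R = X * Q := by
    have h1 := h.factor z
    rw [Fin.prod_univ_succ, h.branch_zero_zero ha.le hR0 hR'] at h1
    simp only [hz, map_zero, sub_zero] at h1
    rw [hQ]
    exact h1.trans (by ring)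
  have hQ0 : Q.eval 0 = c := by
    rw [← hc, hRQ]
    simp
  have hQeval : ∀ y : ℝ, Q.eval y =
      R.leadingCoeff * (-1) ^ (M + 1) * ∏ j : Fin (M + 1), ((φ j.succ z : ℝ) - y) := by
    intro y
    have h1 : ∏ j : Fin (M + 1), (y - (φ j.succ z : ℝ)) =
        (-1) ^ (M + 1) * ∏ j : Fin (M + 1), ((φ j.succ z : ℝ) - y) := by
      rw [← Fin.prod_const, ← Finset.prod_mul_distrib]
      exact Finset.prod_congr rfl fun j _ => by ring
    rw [hQ, eval_mul, eval_C, eval_prod]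
    simp only [eval_sub, eval_X, eval_C]
    rw [h1, mul_assoc]
  have hK : 0 ≤ R.leadingCoeff * (-1) ^ (M + 1) := by
    by_contra! hneg
    have h1 := hQeval 0
    have h2 : 0 ≤ ∏ j : Fin (M + 1), ((φ j.succ z : ℝ) - 0) :=
      Finset.prod_nonneg fun j _ => by simpa using (φ j.succ z).2.1
    have := mul_nonpos_of_nonpos_of_nonneg hneg.le h2
    linarith
  refine ⟨Q, hRQ, hQ0, fun y _ y' hy' hyy' => ?_⟩
  simp only [hQeval]
  refine mul_le_mul_of_nonneg_left (Finset.prod_le_prod (fun j _ => ?_) fun j _ => ?_) hK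
  · have : (φ 0 ⟨a, ha.le, le_rfl⟩ : ℝ) ≤ φ j.succ z :=
      h.branch_le_branch hR (Fin.succ_pos j) _ _
    linarith [hy'.2]
  · linarith

/-- The rescaled iterates of the inverse branch fixing `0` increase to a Koenigs function. -/
theorem exists_koenigs (h : IsBranchSystem R a φ) (ha : 0 < a) (hR0 : R.eval 0 = 0)
    (hc : R.derivative.eval 0 = c) (hc0 : 0 < c) :
    ∃ Φ : Set.Icc 0 a → ℝ, ∀ x : Set.Icc 0 a,
      Tendsto (fun k => c ^ k * ((φ 0)^[k] x : ℝ)) atTop (nhds (Φ x)) ∧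
      ∀ k, (x : ℝ) ≤ c ^ k * ((φ 0)^[k] x : ℝ) ∧ c ^ k * ((φ 0)^[k] x : ℝ) ≤ Φ x := by
  obtain ⟨Q, hRQ, hQ0, hanti⟩ := h.exists_eq_X_mul ha hR0 hc hc0
  have hR : R.derivative ≠ 0 := by
    intro h0
    rw [h0] at hc
    simp at hc
    exact hc0.ne hc
  have hR' : R ≠ 0 := by rintro rfl; simp at hR
  have hmono := h.branch_zero_monotone ha hR0 hR'
  set A : Set.Icc 0 a := ⟨a, ha.le, le_rfl⟩ with hA
  set b : ℝ := ((φ 0 A : Set.Icc 0 a) : ℝ) with hb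
  have hb0 : 0 < b := h.branch_zero_pos hR0 A ha
  have hba : b < a := h.branch_zero_lt ha hR
  have hyb : ∀ x, (φ 0 x : ℝ) ≤ b := fun x => hmono (show x ≤ A from x.2.2)
  have hxy : ∀ x : Set.Icc 0 a, (x : ℝ) = φ 0 x * Q.eval (φ 0 x : ℝ) := fun x => by
    conv_lhs => rw [← h.eval_branch 0 x, hRQ]
    simp
  have hQb : Q.eval b = a / b := by
    rw [eq_div_iff hb0.ne', mul_comm]
    exact (hxy A).symm
  have hlow : ∀ x : Set.Icc 0 a, (x : ℝ) ≤ c * φ 0 x := fun x => by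
    have h1 : Q.eval (φ 0 x : ℝ) ≤ Q.eval 0 :=
      hanti ⟨le_rfl, hb0.le⟩ ⟨(φ 0 x).2.1, hyb x⟩ (φ 0 x).2.1
    rw [hQ0] at h1
    rw [hxy x, mul_comm c]
    convert mul_le_mul_of_nonneg_left h1 (φ 0 x).2.1 using 2
  have hcontr : ∀ x : Set.Icc 0 a, (φ 0 x : ℝ) ≤ b / a * x := fun x => by
    have h1 : Q.eval b ≤ Q.eval (φ 0 x : ℝ) :=
      hanti ⟨(φ 0 x).2.1, hyb x⟩ ⟨hb0.le, le_rfl⟩ (hyb x)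
    rw [hQb] at h1
    have h2 := mul_le_mul_of_nonneg_left h1 (φ 0 x).2.1
    rw [← hxy x] at h2
    rw [div_mul_eq_mul_div, le_div_iff₀ ha]
    rw [mul_div_assoc', div_le_iff₀ hb0] at h2
    linarith
  have hr1 : b / a < 1 := (div_lt_one ha).2 hba
  have hr0 : 0 ≤ b / a := (div_pos hb0 ha).le
  obtain ⟨S, hS⟩ : X ∣ Q - C c := by
    rw [X_dvd_iff, coeff_zero_eq_eval_zero]
    simp [hQ0]
  obtain ⟨K, hK⟩ := (isCompact_Icc (a := (0 : ℝ)) (b := a)).exists_bound_of_continuousOn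
    (f := fun y => S.eval y) S.continuous.continuousOn
  have hK0 : 0 ≤ K := (norm_nonneg _).trans (hK 0 ⟨le_rfl, ha.le⟩)
  have hup : ∀ x : Set.Icc 0 a, c * φ 0 x ≤ x * Real.exp (K * φ 0 x) := fun x => by
    set y : ℝ := ((φ 0 x : Set.Icc 0 a) : ℝ) with hy
    have hy0 : 0 ≤ y := (φ 0 x).2.1
    have h1 : Q.eval y = c + y * S.eval y := by
      have := congrArg (Polynomial.eval y) hS
      simp only [eval_sub, eval_C, eval_mul, eval_X] at this
      linarith
    have h2 : -K ≤ S.eval y := (abs_le.1 (hK y (φ 0 x).2)).1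
    have h3 : y ≤ x := (hcontr x).trans (mul_le_of_le_one_left x.2.1 hr1.le)
    have h4 : (x : ℝ) = y * (c + y * S.eval y) := by rw [← h1]; exact hxy x
    have h5 : c * y ≤ x + K * y * y := by
      rw [h4]
      nlinarith [mul_nonneg hy0 hy0]
    have h6 : K * y * y ≤ K * y * x := mul_le_mul_of_nonneg_left h3 (mul_nonneg hK0 hy0)
    have h7 := mul_le_mul_of_nonneg_left (Real.add_one_le_exp (K * y)) x.2.1
    nlinarith
  have hdecay : ∀ x : Set.Icc 0 a, ∀ k, ((φ 0)^[k] x : ℝ) ≤ a * (b / a) ^ k := by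
    intro x k
    induction k with
    | zero => simpa using x.2.2
    | succ k ih =>
      rw [Function.iterate_succ_apply', pow_succ]
      refine (hcontr _).trans ?_
      calc _ ≤ b / a * (a * (b / a) ^ k) := mul_le_mul_of_nonneg_left ih hr0
        _ = _ := by ring
  have hsum : Summable fun k : ℕ => K * (a * (b / a) ^ (k + 1)) :=
    (((summable_nat_add_iff 1).2 (summable_geometric_of_lt_one hr0 hr1)).mul_left a).mul_left K
  have hmono_k : ∀ x : Set.Icc 0 a, Monotone fun k => c ^ k * ((φ 0)^[k] x : ℝ) := by
    refine fun x => monotone_nat_of_le_succ fun k => ?_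
    simp only [Function.iterate_succ_apply', pow_succ]
    rw [mul_assoc]
    exact mul_le_mul_of_nonneg_left (hlow _) (by positivity)
  have hbdd : ∀ x : Set.Icc 0 a, ∀ k, c ^ k * ((φ 0)^[k] x : ℝ) ≤
      x * Real.exp (∑ i ∈ Finset.range k, K * (a * (b / a) ^ (i + 1))) := by
    intro x k
    induction k with
    | zero => simp
    | succ k ih =>
      rw [Finset.sum_range_succ, Real.exp_add, ← mul_assoc]
      have h1 := hup ((φ 0)^[k] x)
      have h2 := hdecay x (k + 1)
      rw [Function.iterate_succ_apply'] at h2 ⊢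
      calc c ^ (k + 1) * (φ 0 ((φ 0)^[k] x) : ℝ)
          = c ^ k * (c * φ 0 ((φ 0)^[k] x)) := by ring
        _ ≤ c ^ k * (((φ 0)^[k] x : ℝ) * Real.exp (K * φ 0 ((φ 0)^[k] x))) :=
            mul_le_mul_of_nonneg_left h1 (by positivity)
        _ = (c ^ k * ((φ 0)^[k] x : ℝ)) * Real.exp (K * φ 0 ((φ 0)^[k] x)) := by ring
        _ ≤ _ := mul_le_mul ih (Real.exp_le_exp.2 (mul_le_mul_of_nonneg_left h2 hK0))
            (Real.exp_pos _).le (mul_nonneg x.2.1 (Real.exp_pos _).le)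
  have hbd : ∀ x : Set.Icc 0 a,
      BddAbove (Set.range fun k => c ^ k * ((φ 0)^[k] x : ℝ)) := by
    rintro x
    refine ⟨x * Real.exp (∑' i : ℕ, K * (a * (b / a) ^ (i + 1))), ?_⟩
    rintro _ ⟨k, rfl⟩
    refine (hbdd x k).trans (mul_le_mul_of_nonneg_left (Real.exp_le_exp.2 ?_) x.2.1)
    exact hsum.sum_le_tsum _ fun i _ => by positivity
  refine ⟨fun x => ⨆ k, c ^ k * ((φ 0)^[k] x : ℝ), fun x =>
    ⟨tendsto_atTop_ciSup (hmono_k x) (hbd x), fun k => ⟨?_, le_ciSup (hbd x) k⟩⟩⟩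
  simpa using hmono_k x (Nat.zero_le k)

end IsBranchSystem

theorem eVariationOn_add_le {α E : Type*} [LinearOrder α] [SeminormedAddCommGroup E]
    (f g : α → E) (s : Set α) :
    eVariationOn (f + g) s ≤ eVariationOn f s + eVariationOn g s := by
  refine iSup_le fun ⟨n, u, hu, us⟩ => ?_
  calc ∑ i ∈ Finset.range n, edist ((f + g) (u (i + 1))) ((f + g) (u i))
      ≤ ∑ i ∈ Finset.range n, (edist (f (u (i + 1))) (f (u i)) +
          edist (g (u (i + 1))) (g (u i))) := Finset.sum_le_sum fun i _ => edist_add_add_le _ _ _ _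
    _ ≤ _ := by
      rw [Finset.sum_add_distrib]
      exact add_le_add (eVariationOn.sum_le hu us) (eVariationOn.sum_le hu us)

/-- The transfer operator `h ↦ ∑ j ∈ J, h ∘ φ j`. -/
noncomputable def transfer {α ι : Type*} (φ : ι → α → α) (J : Finset ι) :
    Module.End ℂ (α → ℂ) :=
  ∑ j ∈ J, LinearMap.funLeft ℂ ℂ (φ j)

section transfer

variable {α ι : Type*} (φ : ι → α → α)

theorem transfer_apply (J : Finset ι) (h : α → ℂ) (x : α) :
    transfer φ J h x = ∑ j ∈ J, h (φ j x) := by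
  simp [transfer, LinearMap.sum_apply, Finset.sum_apply, LinearMap.funLeft_apply]

theorem transfer_singleton_pow (i : ι) (k : ℕ) (h : α → ℂ) (x : α) :
    (transfer φ {i} ^ k) h x = h ((φ i)^[k] x) := by
  induction k generalizing x with
  | zero => rfl
  | succ k ih =>
    rw [pow_succ', Module.End.mul_apply, transfer_apply, Finset.sum_singleton, ih,
      Function.iterate_succ_apply]

theorem tendsto_transfer (J : Finset ι) {h : ℕ → α → ℂ} {g : α → ℂ}
    (hh : ∀ x, Tendsto (fun k => h k x) atTop (nhds (g x))) (x : α) :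
    Tendsto (fun k => transfer φ J (h k) x) atTop (nhds (transfer φ J g x)) := by
  simp only [transfer_apply]
  exact tendsto_finsetSum _ fun j _ => hh _

theorem tendsto_transfer_pow (J : Finset ι) (m : ℕ) {h : ℕ → α → ℂ} {g : α → ℂ}
    (hh : ∀ x, Tendsto (fun k => h k x) atTop (nhds (g x))) (x : α) :
    Tendsto (fun k => (transfer φ J ^ m) (h k) x) atTop (nhds ((transfer φ J ^ m) g x)) := by
  induction m generalizing x with
  | zero => exact hh x
  | succ m ih =>
    simp only [pow_succ', Module.End.mul_apply]
    exact tendsto_transfer φ J ih x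

theorem differentiable_transfer (J : Finset ι) {h : ℂ → α → ℂ}
    (hh : ∀ x, Differentiable ℂ fun s => h s x) (x : α) :
    Differentiable ℂ fun s => transfer φ J (h s) x := by
  simp only [transfer_apply]
  exact Differentiable.fun_sum fun j _ => hh _

theorem differentiable_transfer_pow (J : Finset ι) (m : ℕ) {h : ℂ → α → ℂ}
    (hh : ∀ x, Differentiable ℂ fun s => h s x) (x : α) :
    Differentiable ℂ fun s => (transfer φ J ^ m) (h s) x := by
  induction m generalizing x with
  | zero => exact hh x
  | succ m ih =>
    simp only [pow_succ', Module.End.mul_apply]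
    exact differentiable_transfer φ J ih x

end transfer

theorem add_pow_eq_pow_add_sum {A : Type*} [Ring A] (x y : A) (n : ℕ) :
    (x + y) ^ n = x ^ n + ∑ m ∈ Finset.range n, (x + y) ^ m * y * x ^ (n - 1 - m) := by
  induction n with
  | zero => simp
  | succ n ih =>
    rw [Finset.sum_range_succ]
    have h1 : ∑ m ∈ Finset.range n, (x + y) ^ m * y * x ^ (n + 1 - 1 - m) =
        (∑ m ∈ Finset.range n, (x + y) ^ m * y * x ^ (n - 1 - m)) * x := by
      rw [Finset.sum_mul]
      refine Finset.sum_congr rfl fun m hm => ?_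
      rw [mul_assoc _ _ x, ← pow_succ]
      congr 2
      have := Finset.mem_range.1 hm
      omega
    rw [h1, pow_succ, mul_add]
    nth_rewrite 1 [ih]
    simp [add_mul, pow_succ, add_assoc]

section variation

variable {α ι : Type*} [LinearOrder α] [LinearOrder ι] {φ : ι → α → α}

theorem eVariationOn_transfer_le (hφ : ∀ j, Monotone (φ j) ∨ Antitone (φ j))
    (hord : ∀ i j, i < j → ∀ x y, φ i x ≤ φ j y) (h : α → ℂ) (J : Finset ι) :
    eVariationOn (transfer φ J h) Set.univ ≤ eVariationOn h (⋃ j ∈ J, Set.range (φ j)) := by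
  induction J using Finset.induction_on_max with
  | empty =>
    rw [eVariationOn.constant_on]
    · exact bot_le
    · rintro _ ⟨x, -, rfl⟩ _ ⟨y, -, rfl⟩
      simp [transfer_apply]
  | insert i J hJ ih =>
    have h1 : transfer φ (insert i J) h = transfer φ J h + h ∘ φ i := by
      funext x
      simp [transfer_apply, Finset.sum_insert (fun hi => (hJ i hi).false), add_comm]
    have h2 : eVariationOn (h ∘ φ i) Set.univ ≤ eVariationOn h (Set.range (φ i)) := by
      rcases hφ i with hm | hm
      · exact eVariationOn.comp_le_of_monotoneOn h _ (hm.monotoneOn _) fun x _ => ⟨x, rfl⟩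
      · exact eVariationOn.comp_le_of_antitoneOn h _ (hm.antitoneOn _) fun x _ => ⟨x, rfl⟩
    rw [h1]
    refine (eVariationOn_add_le _ _ _).trans ((add_le_add ih h2).trans
      ((eVariationOn.add_le_union h ?_).trans (eVariationOn.mono h ?_)))
    · intro x hx y hy
      simp only [Set.mem_iUnion] at hx
      obtain ⟨j, hj, x, rfl⟩ := hx
      obtain ⟨y, rfl⟩ := hy
      exact hord j i (hJ j hj) x y
    · intro x hx
      simp only [Set.mem_union, Set.mem_iUnion, Finset.mem_insert, exists_prop] at hx ⊢
      rcases hx with ⟨j, hj, hx⟩ | hx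
      · exact ⟨j, Or.inr hj, hx⟩
      · exact ⟨i, Or.inl rfl, hx⟩

theorem eVariationOn_transfer_pow_le (hφ : ∀ j, Monotone (φ j) ∨ Antitone (φ j))
    (hord : ∀ i j, i < j → ∀ x y, φ i x ≤ φ j y) (h : α → ℂ) (J : Finset ι) (m : ℕ) :
    eVariationOn ((transfer φ J ^ m) h) Set.univ ≤ eVariationOn h Set.univ := by
  induction m with
  | zero => rfl
  | succ m ih =>
    rw [pow_succ', Module.End.mul_apply]
    exact ((eVariationOn_transfer_le hφ hord _ J).trans
      (eVariationOn.mono _ (Set.subset_univ _))).trans ih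

theorem norm_transfer_pow_succ_sub_le (hφ : ∀ j, Monotone (φ j) ∨ Antitone (φ j))
    (hord : ∀ i j, i < j → ∀ x y, φ i x ≤ φ j y) (h : α → ℂ) (J : Finset ι) (m : ℕ) {V : ℝ}
    (hV0 : 0 ≤ V) (hV : eVariationOn h Set.univ ≤ ENNReal.ofReal V) (x : α) :
    ‖(transfer φ J ^ (m + 1)) h x - J.card * (transfer φ J ^ m) h x‖ ≤ J.card * V := by
  rw [pow_succ', Module.End.mul_apply, transfer_apply, ← nsmul_eq_mul, ← Finset.sum_const,
    ← Finset.sum_sub_distrib, ← nsmul_eq_mul, ← Finset.sum_const]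
  refine norm_sum_le_of_le _ fun j _ => ?_
  rw [← dist_eq_norm, ← ENNReal.ofReal_le_ofReal_iff hV0, ← edist_dist]
  exact (eVariationOn.edist_le _ (Set.mem_univ _) (Set.mem_univ _)).trans
    ((eVariationOn_transfer_pow_le hφ hord h J m).trans hV)

end variation

section zetaPow

/-- The power `t ^ (-s / 2)`, with value `0` at `t = 0`. -/
noncomputable def zetaPow (s : ℂ) (t : ℝ) : ℂ := if t = 0 then 0 else (t : ℂ) ^ (-s / 2)

theorem zetaPow_pow_mul {c : ℝ} (hc : 0 < c) (s : ℂ) (k : ℕ) {t : ℝ} (ht : 0 ≤ t) :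
    zetaPow s (c ^ k * t) = ((c : ℂ) ^ (-s / 2)) ^ k * zetaPow s t := by
  induction k with
  | zero => simp
  | succ k ih =>
    rw [pow_succ', pow_succ', mul_assoc, mul_assoc, ← ih]
    by_cases h : t = 0
    · simp [zetaPow, h]
    · have h1 : c * (c ^ k * t) ≠ 0 := by positivity
      have h2 : c ^ k * t ≠ 0 := by positivity
      rw [zetaPow, zetaPow, if_neg h1, if_neg h2, Complex.ofReal_mul,
        Complex.mul_cpow_ofReal_nonneg hc.le (by positivity)]

theorem differentiable_zetaPow (t : ℝ) : Differentiable ℂ fun s => zetaPow s t := by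
  by_cases h : t = 0
  · simp [zetaPow, h]
  · simp only [zetaPow, if_neg h]
    intro s
    exact DifferentiableAt.const_cpow (by fun_prop) (Or.inl (by exact_mod_cast h))

theorem continuousAt_zetaPow (s : ℂ) {t : ℝ} (ht : 0 < t) : ContinuousAt (zetaPow s) t := by
  have h1 : ContinuousAt (fun x : ℝ => (x : ℂ) ^ (-s / 2)) t :=
    (continuousAt_cpow_const (Or.inl (by simpa using ht))).comp
      Complex.continuous_ofReal.continuousAt
  refine h1.congr ?_
  filter_upwards [lt_mem_nhds ht] with x hx
  rw [zetaPow, if_neg hx.ne']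

theorem lipschitzOnWith_zetaPow {b : ℝ} (hb : 0 < b) {s : ℂ} (hs : 0 < s.re) :
    LipschitzOnWith (Real.toNNReal (‖s / 2‖ * b ^ (-s.re / 2 - 1))) (zetaPow s) (Set.Ici b) := by
  have hs0 : -s / 2 ≠ 0 := by
    intro h
    have := congrArg Complex.re h
    simp at this
    linarith
  have hre : (-s / 2 - 1).re = -s.re / 2 - 1 := by simp
  refine Convex.lipschitzOnWith_of_nnnorm_hasDerivWithin_le (convex_Ici b)
    (f' := fun x : ℝ => (-s / 2) * (x : ℂ) ^ (-s / 2 - 1)) (fun x hx => ?_) fun x hx => ?_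
  · have hx0 : 0 < x := hb.trans_le hx
    have h1 := hasDerivAt_ofReal_cpow_const hx0.ne' hs0
    refine (h1.congr_of_eventuallyEq ?_).hasDerivWithinAt
    filter_upwards [lt_mem_nhds hx0] with y hy
    rw [zetaPow, if_neg hy.ne']
  · have hx0 : 0 < x := hb.trans_le hx
    rw [← NNReal.coe_le_coe, coe_nnnorm, Real.coe_toNNReal _ (by positivity), norm_mul,
      Complex.norm_cpow_eq_rpow_re_of_pos hx0, hre, neg_div, norm_neg]
    exact mul_le_mul_of_nonneg_left
      (Real.rpow_le_rpow_of_nonpos hb hx (by linarith)) (norm_nonneg _)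

end zetaPow

section sequences

theorem tendsto_sum_range_convolution {f : ℕ → ℕ → ℂ} {g : ℕ → ℂ} {B : ℕ → ℝ} (hB : Summable B)
    (hf : ∀ m, Tendsto (f m) atTop (nhds (g m))) (hfB : ∀ m k, ‖f m k‖ ≤ B m) :
    Tendsto (fun n => ∑ m ∈ Finset.range n, f m (n - 1 - m)) atTop (nhds (∑' m, g m)) := by
  have h1 : ∀ n, ∑ m ∈ Finset.range n, f m (n - 1 - m) =
      ∑' m, if m < n then f m (n - 1 - m) else 0 := by
    intro n
    rw [tsum_eq_sum (s := Finset.range n) fun m hm => if_neg (by simpa using hm)]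
    exact Finset.sum_congr rfl fun m hm => (if_pos (Finset.mem_range.1 hm)).symm
  simp only [h1]
  refine tendsto_tsum_of_dominated_convergence hB (fun m => ?_) (.of_forall fun n m => ?_)
  · have h2 : Tendsto (fun n => f m (n - 1 - m)) atTop (nhds (g m)) :=
      (hf m).comp ((tendsto_sub_atTop_nat m).comp (tendsto_sub_atTop_nat 1))
    refine h2.congr' ?_
    filter_upwards [eventually_gt_atTop m] with n hn
    rw [if_pos hn]
  · split_ifs
    · exact hfB m _
    · simpa using (norm_nonneg _).trans (hfB m 0)

theorem tendsto_of_tendsto_succ_sub_mul {S : ℕ → ℂ} {q E : ℂ} (hq : ‖q‖ < 1)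
    (h : Tendsto (fun n => S (n + 1) - q * S n) atTop (nhds E)) :
    Tendsto S atTop (nhds (E / (1 - q))) := by
  set e : ℕ → ℂ := fun n => S (n + 1) - q * S n with he
  have hS : ∀ n, S n = q ^ n * S 0 + ∑ m ∈ Finset.range n, q ^ m * e (n - 1 - m) := by
    intro n
    induction n with
    | zero => simp
    | succ n ih =>
      have h1 : S (n + 1) = q * S n + e n := by simp [he]
      rw [h1, Finset.sum_range_succ', ih, mul_add, Finset.mul_sum]
      have h2 : ∑ m ∈ Finset.range n, q ^ (m + 1) * e (n + 1 - 1 - (m + 1)) =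
          ∑ m ∈ Finset.range n, q * (q ^ m * e (n - 1 - m)) := by
        refine Finset.sum_congr rfl fun m _ => ?_
        rw [show n + 1 - 1 - (m + 1) = n - 1 - m by omega]
        ring
      rw [h2]
      simp
      ring
  obtain ⟨B, hB⟩ := h.norm.bddAbove_range
  have hB' : ∀ n, ‖e n‖ ≤ B := fun n => hB ⟨n, rfl⟩
  have h3 : Tendsto (fun n => ∑ m ∈ Finset.range n, q ^ m * e (n - 1 - m)) atTop
      (nhds (∑' m, q ^ m * E)) := by
    refine tendsto_sum_range_convolution (f := fun m k => q ^ m * e k)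
      ((summable_geometric_of_lt_one (norm_nonneg q) hq).mul_right B)
      (fun m => h.const_mul _) fun m k => ?_
    rw [norm_mul, norm_pow]
    exact mul_le_mul_of_nonneg_left (hB' k) (by positivity)
  have h4 := ((tendsto_pow_atTop_nhds_zero_of_norm_lt_one hq).mul_const (S 0)).add h3
  rw [tsum_mul_right, tsum_geometric_of_norm_lt_one hq, zero_mul, zero_add, mul_comm,
    ← div_eq_mul_inv] at h4
  exact h4.congr fun n => (hS n).symm

theorem tendsto_of_eq_add_sum_convolution {S g : ℕ → ℂ} {A : ℕ → ℕ → ℂ} {u ν g' : ℂ}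
    {A' : ℕ → ℂ} {B : ℝ} (hu : ‖u‖ < 1) (hν : ‖ν * u‖ < 1)
    (hS : ∀ n, S n = g n + ∑ m ∈ Finset.range n, u ^ (m + 1) * A m (n - 1 - m))
    (hg : Tendsto g atTop (nhds g')) (hA : ∀ m, Tendsto (A m) atTop (nhds (A' m)))
    (hB : ∀ m k, ‖A (m + 1) k - ν * A m k‖ ≤ B) :
    Tendsto S atTop (nhds ((g' - ν * u * g' + u * A' 0 +
      ∑' m, u ^ (m + 2) * (A' (m + 1) - ν * A' m)) / (1 - ν * u))) := by
  refine tendsto_of_tendsto_succ_sub_mul hν ?_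
  have h1 : ∀ n, S (n + 1) - ν * u * S n = g (n + 1) - ν * u * g n + u * A 0 n +
      ∑ m ∈ Finset.range n, u ^ (m + 2) * (A (m + 1) (n - 1 - m) - ν * A m (n - 1 - m)) := by
    intro n
    rw [hS, hS, Finset.sum_range_succ']
    have h2 : ∑ m ∈ Finset.range n, u ^ (m + 2) * (A (m + 1) (n - 1 - m) - ν * A m (n - 1 - m)) =
        (∑ m ∈ Finset.range n, u ^ (m + 1 + 1) * A (m + 1) (n + 1 - 1 - (m + 1))) -
        ν * u * ∑ m ∈ Finset.range n, u ^ (m + 1) * A m (n - 1 - m) := by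
      rw [Finset.mul_sum, ← Finset.sum_sub_distrib]
      refine Finset.sum_congr rfl fun m _ => ?_
      rw [show n + 1 - 1 - (m + 1) = n - 1 - m by omega]
      ring
    rw [h2]
    simp
    ring
  simp only [h1]
  refine Tendsto.add (((hg.comp (tendsto_add_atTop_nat 1)).sub (hg.const_mul _)).add
    ((hA 0).const_mul _)) ?_
  refine tendsto_sum_range_convolution
    (f := fun m k => u ^ (m + 2) * (A (m + 1) k - ν * A m k))
    (((summable_nat_add_iff 2).2 (summable_geometric_of_lt_one (norm_nonneg u) hu)).mul_right B)
    (fun m => ((hA (m + 1)).sub ((hA m).const_mul _)).const_mul _) fun m k => ?_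
  rw [norm_mul, norm_pow]
  exact mul_le_mul_of_nonneg_left (hB m k) (by positivity)

end sequences

theorem natDegree_polyIter (R : Polynomial ℝ) (n : ℕ) :
    (polyIter R n).natDegree = R.natDegree ^ n := by
  induction n with
  | zero => simp [polyIter]
  | succ n ih => rw [polyIter, natDegree_comp, ih, pow_succ']

namespace IsBranchSystem

variable {R : Polynomial ℝ} {a : ℝ} {N : ℕ} {φ : Fin N → Set.Icc 0 a → Set.Icc 0 a}

theorem sum_map_preimageRoots (h : IsBranchSystem R a φ) (hR : 0 < R.natDegree) (g : ℂ → ℂ)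
    (n : ℕ) (x : Set.Icc 0 a) :
    ((preimageRoots R x n).map g).sum =
      (transfer φ Finset.univ ^ n) (fun y => g ((y : ℝ) : ℂ)) x := by
  induction n generalizing x with
  | zero => simp [preimageRoots, polyIter]
  | succ n ih =>
    have hne : ∀ (k : ℕ) (y : ℝ), (polyIter R k - C y).map (algebraMap ℝ ℂ) ≠ 0 := by
      intro k y h0
      have h1 := congrArg natDegree h0
      rw [natDegree_map, natDegree_sub_C, natDegree_polyIter, natDegree_zero] at h1
      exact (pow_pos hR k).ne' h1
    have h2 : (polyIter R (n + 1) - C (x : ℝ)).map (algebraMap ℝ ℂ) =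
        C (algebraMap ℝ ℂ R.leadingCoeff) *
          ∏ j, (polyIter R n - C (φ j x : ℝ)).map (algebraMap ℝ ℂ) := by
      have h3 := congrArg (fun p => (p.comp (polyIter R n)).map (algebraMap ℝ ℂ)) (h.factor x)
      simpa [polyIter, Polynomial.prod_comp, Polynomial.map_prod] using h3
    have hlead : algebraMap ℝ ℂ R.leadingCoeff ≠ 0 := by
      rw [Ne, map_eq_zero, leadingCoeff_eq_zero]
      rintro rfl
      simp at hR
    rw [preimageRoots, h2, roots_C_mul _ hlead,
      roots_prod _ _ (Finset.prod_ne_zero_iff.2 fun j _ => hne n _), Multiset.map_bind,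
      Multiset.sum_bind, pow_succ', Module.End.mul_apply, transfer_apply]
    exact Finset.sum_congr rfl fun j _ => ih (φ j x)

theorem zetaPartial_eq (h : IsBranchSystem R a φ) (hR : 0 < R.natDegree) {c : ℝ} (hc : 0 < c)
    (n : ℕ) (s : ℂ) (x : Set.Icc 0 a) :
    zetaPartial R c x n s = ((c : ℂ) ^ (-s / 2)) ^ n *
      (transfer φ Finset.univ ^ n) (fun y => zetaPow s y) x := by
  rw [zetaPartial, h.sum_map_preimageRoots hR]
  have h1 : (fun y : Set.Icc 0 a => if ((y : ℝ) : ℂ) = 0 then (0 : ℂ)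
      else ((c : ℂ) ^ n * ((y : ℝ) : ℂ)) ^ (-s / 2)) =
      ((c : ℂ) ^ (-s / 2)) ^ n • fun y : Set.Icc 0 a => zetaPow s y := by
    funext y
    rw [Pi.smul_apply, smul_eq_mul, ← zetaPow_pow_mul hc s n y.2.1, zetaPow]
    by_cases hy : (y : ℝ) = 0
    · simp [hy]
    · rw [if_neg (by exact_mod_cast hy), if_neg (by positivity)]
      push_cast
      rfl
  rw [h1, map_smul, Pi.smul_apply, smul_eq_mul]

end IsBranchSystem

theorem analyticAt_tsum_pow_mul {u : ℂ → ℂ} {D : ℕ → ℂ → ℂ} {W : ℂ → ℝ} {s₀ : ℂ}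
    (hu : Differentiable ℂ u) (hu1 : ‖u s₀‖ < 1) (hD : ∀ m, Differentiable ℂ (D m))
    (hW : ContinuousAt W s₀) (hDW : ∀ᶠ s in nhds s₀, ∀ m, ‖D m s‖ ≤ W s) :
    AnalyticAt ℂ (fun s => ∑' m, u s ^ (m + 2) * D m s) s₀ := by
  obtain ⟨r, hr, hr1⟩ := exists_between hu1
  have h1 : ∀ᶠ s in nhds s₀, ‖u s‖ < r := hu.continuous.norm.continuousAt.eventually_lt_const hr
  have h2 : ∀ᶠ s in nhds s₀, W s < W s₀ + 1 := hW.eventually_lt_const (by linarith)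
  obtain ⟨V, hV, hVo, hs₀⟩ := eventually_nhds_iff.1 (h1.and (h2.and hDW))
  have hr0 : 0 ≤ r := (norm_nonneg _).trans hr.le
  refine DifferentiableOn.analyticAt (s := V) ?_ (hVo.mem_nhds hs₀)
  refine Complex.differentiableOn_tsum_of_summable_norm
    (u := fun m => r ^ (m + 2) * (W s₀ + 1))
    (((summable_nat_add_iff 2).2 (summable_geometric_of_lt_one hr0 hr1)).mul_right _)
    (fun m => ((hu.pow _).mul (hD m)).differentiableOn) hVo fun m s hs => ?_
  obtain ⟨h3, h4, h5⟩ := hV s hs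
  rw [norm_mul, norm_pow]
  exact mul_le_mul (pow_le_pow_left₀ (norm_nonneg _) h3.le _) ((h5 m).trans h4.le)
    (norm_nonneg _) (by positivity)

namespace IsBranchSystem

variable {R : Polynomial ℝ} {a c : ℝ} {M : ℕ} {φ : Fin (M + 2) → Set.Icc 0 a → Set.Icc 0 a}

theorem zetaPartial_eq_add_sum (h : IsBranchSystem R a φ) (hR : 0 < R.natDegree) (hc : 0 < c)
    (n : ℕ) (s : ℂ) (x : Set.Icc 0 a) :
    zetaPartial R c x n s = zetaPow s (c ^ n * ((φ 0)^[n] x : Set.Icc 0 a)) +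
      ∑ m ∈ Finset.range n, ((c : ℂ) ^ (-s / 2)) ^ (m + 1) *
        (transfer φ Finset.univ ^ m) (transfer φ (Finset.univ.erase 0)
          fun y => zetaPow s (c ^ (n - 1 - m) * ((φ 0)^[n - 1 - m] y : Set.Icc 0 a))) x := by
  have h1 : transfer φ Finset.univ = transfer φ {0} + transfer φ (Finset.univ.erase 0) := by
    rw [transfer, transfer, transfer, Finset.sum_singleton]
    exact (Finset.add_sum_erase _ _ (Finset.mem_univ _)).symm
  have h2 : ∀ k, (fun y : Set.Icc 0 a => zetaPow s (c ^ k * ((φ 0)^[k] y : Set.Icc 0 a))) =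
      ((c : ℂ) ^ (-s / 2)) ^ k • (transfer φ {0} ^ k) fun y => zetaPow s y := by
    intro k
    funext y
    rw [Pi.smul_apply, transfer_singleton_pow, smul_eq_mul,
      zetaPow_pow_mul hc _ _ ((φ 0)^[k] y).2.1]
  rw [h.zetaPartial_eq hR hc]
  nth_rewrite 1 [h1]
  rw [add_pow_eq_pow_add_sum, ← h1, LinearMap.add_apply, Pi.add_apply, mul_add,
    congrFun (h2 n) x, Pi.smul_apply, smul_eq_mul, LinearMap.sum_apply, Finset.sum_apply,
    Finset.mul_sum]
  congr 1
  refine Finset.sum_congr rfl fun m hm => ?_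
  rw [h2, map_smul, map_smul, Pi.smul_apply, smul_eq_mul, Module.End.mul_apply,
    Module.End.mul_apply, ← mul_assoc, ← pow_add]
  have := Finset.mem_range.1 hm
  congr 2
  omega

theorem eVariationOn_transfer_erase_zero_le (h : IsBranchSystem R a φ) (ha : 0 < a)
    (hR0 : R.eval 0 = 0) (hR : R.derivative ≠ 0) (hc : 0 < c) {C : ℝ} {k : ℕ}
    (hk : ∀ y : Set.Icc 0 a, (y : ℝ) ≤ c ^ k * ((φ 0)^[k] y : Set.Icc 0 a))
    (hC : c ^ k * ((φ 0)^[k] ⟨a, ha.le, le_rfl⟩ : Set.Icc 0 a) ≤ C) {s : ℂ} (hs : 0 < s.re) :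
    eVariationOn (transfer φ (Finset.univ.erase 0)
      fun y => zetaPow s (c ^ k * ((φ 0)^[k] y : Set.Icc 0 a))) Set.univ ≤
      ENNReal.ofReal (‖s / 2‖ * (φ 0 ⟨a, ha.le, le_rfl⟩ : ℝ) ^ (-s.re / 2 - 1) * C) := by
  have hR' : R ≠ 0 := by
    rintro rfl
    simp at hR
  set t : Set.Icc 0 a := ⟨a, ha.le, le_rfl⟩
  set b : Set.Icc 0 a := φ 0 t
  have hb0 : (0 : ℝ) < b := h.branch_zero_pos hR0 t ha
  have hord := fun i j (hij : i < j) => h.branch_le_branch hR hij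
  refine (eVariationOn_transfer_le (h.monotone_or_antitone ha.le) hord _ _).trans
    ((eVariationOn.mono (s := Set.univ ∩ Set.Icc b t) _ ?_).trans ?_)
  · intro y hy
    simp only [Set.mem_iUnion, Finset.mem_erase] at hy
    obtain ⟨j, ⟨hj, -⟩, y, rfl⟩ := hy
    exact ⟨trivial, hord 0 j (Fin.pos_iff_ne_zero.2 hj) t y, (φ j y).2.2⟩
  · have hmono : Monotone fun y : Set.Icc 0 a => c ^ k * ((φ 0)^[k] y : Set.Icc 0 a) :=
      fun y z hyz => mul_le_mul_of_nonneg_left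
        ((h.branch_zero_monotone ha hR0 hR').iterate k hyz) (by positivity)
    have hmaps : Set.MapsTo (fun y : Set.Icc 0 a => c ^ k * (((φ 0)^[k] y : Set.Icc 0 a) : ℝ))
        (Set.univ ∩ Set.Icc b t) (Set.Ici (b : ℝ)) :=
      fun y hy => (show (b : ℝ) ≤ y from hy.2.1).trans (hk y)
    have h1 := (lipschitzOnWith_zetaPow hb0 hs).comp_eVariationOn_le hmaps
    refine h1.trans ?_
    rw [(hmono.monotoneOn _).eVariationOn_eq (Set.mem_univ b) (Set.mem_univ t),
      ENNReal.ofReal_mul (by positivity)]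
    gcongr
    · rfl
    · refine (sub_le_self _ ?_).trans hC
      exact mul_nonneg (by positivity) ((φ 0)^[k] b).2.1

end IsBranchSystem

theorem norm_ofReal_cpow_neg_div_two {c : ℝ} (hc : 0 < c) (s : ℂ) :
    ‖(c : ℂ) ^ (-s / 2)‖ = c ^ (-s.re / 2) := by
  rw [Complex.norm_cpow_eq_rpow_re_of_pos hc]
  simp

theorem norm_ofReal_cpow_neg_div_two_lt_one {c : ℝ} (hc : 1 < c) {s : ℂ} (hs : 0 < s.re) :
    ‖(c : ℂ) ^ (-s / 2)‖ < 1 := by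
  rw [norm_ofReal_cpow_neg_div_two (by linarith)]
  exact Real.rpow_lt_one_of_one_lt_of_neg hc (by linarith)

theorem norm_natCast_mul_cpow_lt_one {c : ℝ} (hc : 1 < c) {N : ℕ} (hN : 0 < N) {s : ℂ}
    (hs : 2 * Real.log N / Real.log c < s.re) : ‖(N : ℂ) * (c : ℂ) ^ (-s / 2)‖ < 1 := by
  have hc0 : 0 < c := by linarith
  have hN0 : (0 : ℝ) < N := by exact_mod_cast hN
  rw [div_lt_iff₀ (Real.log_pos hc)] at hs
  rw [norm_mul, norm_ofReal_cpow_neg_div_two hc0, Complex.norm_natCast,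
    Real.rpow_def_of_pos hc0, ← Real.exp_log hN0, ← Real.exp_add, Real.exp_lt_one_iff]
  linarith

theorem exists_int_of_natCast_mul_cpow_eq_one {c : ℝ} (hc : 1 < c) {N : ℕ} (hN : 0 < N) {s : ℂ}
    (hs : (N : ℂ) * (c : ℂ) ^ (-s / 2) = 1) :
    ∃ k : ℤ, s = (2 * Real.log N / Real.log c : ℝ)
      + 4 * Real.pi * Complex.I * (k : ℂ) / (Real.log c : ℂ) := by
  have hc0 : (c : ℂ) ≠ 0 := by exact_mod_cast (by linarith : c ≠ 0)
  have hN0 : (0 : ℝ) < N := by exact_mod_cast hN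
  have hl : (Real.log c : ℂ) ≠ 0 := by exact_mod_cast (Real.log_pos hc).ne'
  rw [Complex.cpow_def_of_ne_zero hc0, ← Complex.ofReal_log (by linarith), ← Complex.ofReal_natCast,
    ← Real.exp_log hN0, Complex.ofReal_exp, ← Complex.exp_add,
    Complex.exp_eq_one_iff] at hs
  obtain ⟨k, hk⟩ := hs
  refine ⟨-k, ?_⟩
  push_cast at hk ⊢
  field_simp
  linear_combination -2 * hk

theorem zeta_of_polynomial_poles_in_arithmetic_progression
    (R : Polynomial ℝ) (N : ℕ) (hN : R.natDegree = N) (hN2 : 2 ≤ N)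
    (hR0 : R.eval 0 = 0) (c : ℝ) (hc : R.derivative.eval 0 = c) (hc1 : 1 < c)
    (a : ℝ) (ha : 0 < a)
    (hinv : ∀ z : ℂ, memIcc a (Polynomial.aeval z R) → memIcc a z)
    (z₀ : ℝ) (hz₀ : z₀ ∈ Set.Icc 0 a) :
    ∃ F : ℂ → ℂ,
      (∀ s : ℂ, 2 * Real.log N / Real.log c < s.re →
        Filter.Tendsto (fun n => zetaPartial R c z₀ n s) Filter.atTop (nhds (F s))) ∧
      MeromorphicOn F {s : ℂ | 0 < s.re} ∧
      ∀ s : ℂ, 0 < s.re →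
        (¬ ∃ k : ℤ, s = (2 * Real.log N / Real.log c : ℝ)
            + 4 * Real.pi * Complex.I * (k : ℂ) / (Real.log c : ℂ)) →
        AnalyticAt ℂ F s := by
  obtain ⟨M, rfl⟩ : ∃ M, N = M + 2 := ⟨N - 2, by omega⟩
  have hc0 : 0 < c := by linarith
  have hcC : (c : ℂ) ≠ 0 := by exact_mod_cast hc0.ne'
  have hR' : R.derivative ≠ 0 := by
    intro h0
    rw [h0, eval_zero] at hc
    linarith
  have hR : R ≠ 0 := by
    rintro rfl
    simp at hR'
  obtain ⟨φ, h⟩ := exists_isBranchSystem hN (by omega) hinv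
  obtain ⟨Φ, hΦ⟩ := h.exists_koenigs ha hR0 hc hc0
  set t : Set.Icc 0 a := ⟨a, ha.le, le_rfl⟩
  set x : Set.Icc 0 a := ⟨z₀, hz₀⟩
  set b : ℝ := (φ 0 t : ℝ)
  have hb0 : 0 < b := h.branch_zero_pos hR0 t ha
  have hφ := h.monotone_or_antitone ha.le
  have hord := fun i j (hij : i < j) => h.branch_le_branch hR' hij
  set L := transfer φ Finset.univ
  set L' := transfer φ (Finset.univ.erase 0)
  set u : ℂ → ℂ := fun s => (c : ℂ) ^ (-s / 2)
  set g : ℕ → ℂ → Set.Icc 0 a → ℂ :=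
    fun k s y => zetaPow s (c ^ k * ((φ 0)^[k] y : Set.Icc 0 a)) with hg
  set G : ℂ → Set.Icc 0 a → ℂ := fun s y => zetaPow s (Φ y) with hG
  set A : ℕ → ℂ → ℂ := fun m s => (L ^ m) (L' (G s)) x
  set W : ℂ → ℝ := fun s => ((M + 2 : ℕ) : ℝ) * (‖s / 2‖ * b ^ (-s.re / 2 - 1) * Φ t)
  have hgG : ∀ s y, Tendsto (fun k => g k s y) atTop (nhds (G s y)) := by
    intro s y
    rcases y.2.1.eq_or_lt with hy | hy
    · have hy0 : y = ⟨0, le_rfl, ha.le⟩ := Subtype.ext hy.symm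
      have h1 : ∀ k, c ^ k * (((φ 0)^[k] y : Set.Icc 0 a) : ℝ) = 0 := by
        intro k
        rw [hy0, Function.iterate_fixed (h.branch_zero_zero ha.le hR0 hR), mul_zero]
      have h2 : Φ y = 0 := by
        have h3 := (hΦ y).1
        simp only [h1] at h3
        exact (tendsto_nhds_unique h3 tendsto_const_nhds)
      simp only [hg, hG, h1, h2]
      exact tendsto_const_nhds
    · have h1 : 0 < Φ y := hy.trans_le (((hΦ y).2 0).1.trans ((hΦ y).2 0).2)
      exact (continuousAt_zetaPow s h1).tendsto.comp (hΦ y).1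
  have hAk : ∀ s m, Tendsto (fun k => (L ^ m) (L' (g k s)) x) atTop (nhds (A m s)) := fun s m =>
    tendsto_transfer_pow φ _ m (tendsto_transfer φ _ (hgG s)) x
  have hΦt : 0 ≤ Φ t := ha.le.trans (((hΦ t).2 0).1.trans ((hΦ t).2 0).2)
  have hbound : ∀ s, 0 < s.re → ∀ m k, ‖(L ^ (m + 1)) (L' (g k s)) x -
      ((M + 2 : ℕ) : ℂ) * (L ^ m) (L' (g k s)) x‖ ≤ W s := by
    intro s hs m k
    have h1 := norm_transfer_pow_succ_sub_le hφ hord (L' (g k s)) Finset.univ m (by positivity)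
      (h.eVariationOn_transfer_erase_zero_le ha hR0 hR' hc0 (fun y => ((hΦ y).2 k).1)
        ((hΦ t).2 k).2 hs) x
    rwa [Finset.card_univ, Fintype.card_fin] at h1
  have hud : Differentiable ℂ u := fun s =>
    DifferentiableAt.const_cpow (by fun_prop) (Or.inl hcC)
  have hGd : ∀ y, Differentiable ℂ fun s => G s y := fun y => differentiable_zetaPow (Φ y)
  have hAd : ∀ m, Differentiable ℂ (A m) := fun m =>
    differentiable_transfer_pow φ _ m (differentiable_transfer φ _ hGd) x
  have hWc : Continuous W := by
    have : ∀ s : ℂ, b ≠ 0 ∨ 0 < -s.re / 2 - 1 := fun _ => Or.inl hb0.ne'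
    have h1 : Continuous fun s : ℂ => b ^ (-s.re / 2 - 1) :=
      Continuous.rpow continuous_const (by fun_prop) this
    fun_prop
  have hE : ∀ s, 0 < s.re → AnalyticAt ℂ (fun s => G s x - ((M + 2 : ℕ) : ℂ) * u s * G s x +
      u s * A 0 s + ∑' m, u s ^ (m + 2) * (A (m + 1) s - ((M + 2 : ℕ) : ℂ) * A m s)) s := by
    intro s hs
    have hua := hud.analyticAt s
    have hGa := (hGd x).analyticAt s
    have hAa := (hAd 0).analyticAt s
    refine AnalyticAt.add (by fun_prop) (analyticAt_tsum_pow_mul (W := W) hud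
      (norm_ofReal_cpow_neg_div_two_lt_one hc1 hs)
      (fun m => (hAd (m + 1)).sub ((hAd m).const_mul _)) hWc.continuousAt ?_)
    filter_upwards [Complex.continuous_re.continuousAt.eventually_const_lt hs] with w hw m
    exact le_of_tendsto (((hAk w (m + 1)).sub ((hAk w m).const_mul _)).norm)
      (.of_forall fun k => hbound w hw m k)
  have hDa : ∀ s, AnalyticAt ℂ (fun s => 1 - ((M + 2 : ℕ) : ℂ) * u s) s := by
    intro s
    have hua := hud.analyticAt s
    fun_prop
  refine ⟨fun s => (G s x - ((M + 2 : ℕ) : ℂ) * u s * G s x + u s * A 0 s +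
      ∑' m, u s ^ (m + 2) * (A (m + 1) s - ((M + 2 : ℕ) : ℂ) * A m s)) /
      (1 - ((M + 2 : ℕ) : ℂ) * u s), fun s hs => ?_, fun s hs => ?_, fun s hs hk => ?_⟩
  · have hs0 : 0 < s.re := by
      refine lt_of_le_of_lt ?_ hs
      exact div_nonneg (mul_nonneg zero_le_two (Real.log_natCast_nonneg _)) (Real.log_pos hc1).le
    have hS : ∀ n, zetaPartial R c z₀ n s = g n s x +
        ∑ m ∈ Finset.range n, u s ^ (m + 1) * (L ^ m) (L' (g (n - 1 - m) s)) x := fun n =>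
      h.zetaPartial_eq_add_sum (by omega) hc0 n s x
    exact tendsto_of_eq_add_sum_convolution (S := fun n => zetaPartial R c z₀ n s)
      (g := fun n => g n s x) (A := fun m k => (L ^ m) (L' (g k s)) x) (A' := fun m => A m s)
      (norm_ofReal_cpow_neg_div_two_lt_one hc1 hs0)
      (norm_natCast_mul_cpow_lt_one hc1 (by omega) hs) hS (hgG s x) (hAk s) (hbound s hs0)
  · exact (hE s hs).meromorphicAt.div (hDa s).meromorphicAt
  · refine (hE s hs).div (hDa s) fun h0 => hk ?_
    exact exists_int_of_natCast_mul_cpow_eq_one hc1 (by omega) (sub_eq_zero.1 h0).symm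
end

section
/- Let R be a polynomial with real coefficients of degree N ≥ 2 such that R(0) = 0, c := R'(0) > 1, and there exists a > 0 with the property that every complex number z with R(z) ∈ [0,a] satisfies z ∈ [0,a]. Fix z₀ ∈ [0,a] and set d_R := 2·log N / log c. Assume in addition that there exist a constant C > 0 and r ∈ (0,1) such that for every n the Lebesgue measure of the set {x ∈ [0,a] : R^{∘n}(x) ∈ [0,a]} is at most C·rⁿ (this holds when the Julia set of R is totally disconnected, with r = max_{z ∈ J_R} |R'(z)|^{-1} when this maximum is < 1). Then there exist an entire function ξ : ℂ → ℂ and a function ψ holomorphic on the half-plane {s : Re(s) > 2·log r / log c} such that ζ_{z₀,R}(s) = ξ(s)/(1 − N·c^{-s/2}) + ψ(s) for all s with Re(s) > d_R; in particular ζ_{z₀,R} has a meromorphic continuation to {s : Re(s) > −ε} with ε := −2·log r / log c > 0. -/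
open Polynomial Filter MeasureTheory

namespace PolynomialZeta

/-! ### Real-rooted polynomials -/

theorem splits_of_complex_roots_real {p : ℝ[X]} (h : ∀ z : ℂ, aeval z p = 0 → z.im = 0) :
    p.Splits := by
  refine Splits.of_splits_map (algebraMap ℝ ℂ) (IsAlgClosed.splits _) fun z hz => ?_
  have hz' := (mem_roots'.1 hz).2
  rw [IsRoot, eval_map_algebraMap] at hz'
  exact ⟨z.re, Complex.ext rfl (h z hz').symm⟩

theorem roots_comp_of_splits {A B : ℝ[X]} (hA : A.Splits) (hB : B.natDegree ≠ 0) :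
    (A.comp B).roots = A.roots.bind fun y => (B - C y).roots := by
  rcases eq_or_ne A 0 with rfl | hA0
  · simp
  have hne : ∀ y, B - C y ≠ 0 := fun y h => hB <| by rw [sub_eq_zero.1 h, natDegree_C]
  conv_lhs => rw [hA.eq_prod_roots]
  rw [mul_comp, C_comp, roots_C_mul _ (leadingCoeff_ne_zero.2 hA0), multiset_prod_comp,
    Multiset.map_map, roots_multiset_prod]
  · simp [Multiset.bind_map]
  · simp only [Multiset.mem_map, Function.comp, sub_comp, X_comp, C_comp]
    rintro ⟨y, -, hy⟩
    exact hne y hy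

/-- Rolle's theorem with multiplicities, for the roots in an order-connected set. -/
theorem card_filter_roots_le_derivative (p : ℝ[X]) (q : ℝ → Prop) [DecidablePred q]
    (hq : {x | q x}.OrdConnected) :
    (p.roots.filter q).card ≤ (p.derivative.roots.filter q).card + 1 := by
  rcases eq_or_ne (derivative p) 0 with hp' | hp'
  · rw [eq_C_of_derivative_eq_zero hp']
    simp
  have hp : p ≠ 0 := ne_of_apply_ne derivative (by rwa [derivative_zero])
  have key : (p.roots.filter q).toFinset.card ≤
      ((p.derivative.roots.filter q).toFinset \ (p.roots.filter q).toFinset).card + 1 := by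
    refine Finset.card_le_sdiff_of_interleaved fun x hx y hy hxy hxy' => ?_
    rw [Multiset.mem_toFinset, Multiset.mem_filter, mem_roots hp] at hx hy
    obtain ⟨z, hz1, hz2⟩ := exists_deriv_eq_zero hxy p.continuousOn (hx.1.trans hy.1.symm)
    refine ⟨z, ?_, hz1⟩
    rw [Multiset.mem_toFinset, Multiset.mem_filter, mem_roots hp', IsRoot, ← p.deriv]
    exact ⟨hz2, hq.out hx.2 hy.2 ⟨hz1.1.le, hz1.2.le⟩⟩
  set m := p.roots.filter q with hm
  set m' := p.derivative.roots.filter q with hm'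
  calc
    m.card = ∑ x ∈ m.toFinset, m.count x := (Multiset.toFinset_sum_count_eq _).symm
    _ = ∑ x ∈ m.toFinset, (m.count x - 1 + 1) :=
      (Eq.symm <| Finset.sum_congr rfl fun _ hx => tsub_add_cancel_of_le <|
        Nat.succ_le_iff.2 <| Multiset.count_pos.2 <| Multiset.mem_toFinset.1 hx)
    _ = (∑ x ∈ m.toFinset, (m.count x - 1)) + m.toFinset.card := by
      simp only [Finset.sum_add_distrib, Finset.card_eq_sum_ones]
    _ ≤ (∑ x ∈ m.toFinset, m'.count x) + ((m'.toFinset \ m.toFinset).card + 1) := by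
      refine add_le_add (Finset.sum_le_sum fun x hx => ?_) key
      have hx := (Multiset.mem_filter.1 (Multiset.mem_toFinset.1 hx)).2
      rw [hm, hm', Multiset.count_filter_of_pos hx, Multiset.count_filter_of_pos hx, count_roots,
        count_roots]
      exact rootMultiplicity_sub_one_le_derivative_rootMultiplicity _ _
    _ ≤ (∑ x ∈ m.toFinset, m'.count x) +
          ((∑ x ∈ m'.toFinset \ m.toFinset, m'.count x) + 1) := by
      simp only [Finset.card_eq_sum_ones]
      gcongr with x hx
      rw [Nat.succ_le_iff, Multiset.count_pos, ← Multiset.mem_toFinset]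
      exact (Finset.mem_sdiff.1 hx).1
    _ = m'.card + 1 := by
      rw [← add_assoc, ← Finset.sum_union Finset.disjoint_sdiff, Finset.union_sdiff_self_eq_union,
        ← Multiset.toFinset_sum_count_eq, ← Finset.sum_subset Finset.subset_union_right]
      intro x _ hx₂
      simpa only [Multiset.mem_toFinset, Multiset.count_eq_zero] using hx₂

/-- The number of roots of `P - u` in `(-∞, t]`, with multiplicity. -/
noncomputable def rootCount (P : ℝ[X]) (u t : ℝ) : ℕ := ((P - C u).roots.filter (· ≤ t)).card

theorem rootCount_le_succ {P : ℝ[X]} (hP : P.natDegree ≠ 0) {u v : ℝ}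
    (hv : (P - C v).Splits) (t : ℝ) :
    rootCount P u t ≤ rootCount P v t + 1 := by
  have h1 := card_filter_roots_le_derivative (P - C u) (· ≤ t) Set.ordConnected_Iic
  have h2 := card_filter_roots_le_derivative (P - C v) (fun x => ¬ x ≤ t)
    (by simp only [not_le]; exact Set.ordConnected_Ioi)
  have h3 : (P - C v).roots.card = P.natDegree := by
    rw [← hv.natDegree_eq_card_roots, natDegree_sub_C]
  have h4 : (P.derivative.roots).card + 1 ≤ P.natDegree :=
    (Nat.add_le_add_right (card_roots' _) 1).trans (natDegree_derivative_lt hP)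
  have h5 := Multiset.card_add (Multiset.filter (· ≤ t) (P - C v).roots)
    (Multiset.filter (fun x => ¬ x ≤ t) (P - C v).roots)
  have h6 := Multiset.card_add (Multiset.filter (· ≤ t) P.derivative.roots)
    (Multiset.filter (fun x => ¬ x ≤ t) P.derivative.roots)
  rw [Multiset.filter_add_not] at h5 h6
  simp only [derivative_sub, derivative_C, sub_zero] at h1 h2
  unfold rootCount
  omega

theorem eval_mul_neg_one_pow_pos {p : ℝ[X]} (hp : p.Splits) (t : ℝ) (ht : p.eval t ≠ 0) :
    0 < p.leadingCoeff * (-1) ^ ((p.roots.filter (fun x => ¬ x ≤ t)).card) * p.eval t := by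
  have hp0 : p ≠ 0 := by rintro rfl; simp at ht
  have hl := leadingCoeff_ne_zero.2 hp0
  have key : ∀ m : Multiset ℝ, (∀ x ∈ m, x ≠ t) →
      0 < (-1) ^ ((m.filter (fun x => ¬ x ≤ t)).card) * (m.map (t - ·)).prod := by
    intro m
    induction m using Multiset.induction_on with
    | empty => simp
    | cons x m ih =>
      intro hm
      have h1 := ih fun y hy => hm y (Multiset.mem_cons_of_mem hy)
      have hx := hm x (Multiset.mem_cons_self _ _)
      rcases lt_or_gt_of_ne hx with h | h
      · rw [Multiset.filter_cons_of_neg _ (by simpa using h.le), Multiset.map_cons,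
          Multiset.prod_cons]
        nlinarith [sub_pos.2 h]
      · rw [Multiset.filter_cons_of_pos _ (by simpa using h), Multiset.map_cons,
          Multiset.prod_cons, Multiset.card_cons, pow_succ]
        nlinarith [sub_pos.2 h]
  have h := key p.roots fun x hx hxt => ht (hxt ▸ (mem_roots'.1 hx).2)
  rw [hp.eval_eq_prod_roots]
  have h2 : 0 < p.leadingCoeff * p.leadingCoeff := mul_self_pos.2 hl
  calc 0 < (p.leadingCoeff * p.leadingCoeff) * _ := mul_pos h2 h
    _ = _ := by ring

theorem rootCount_eq_of_mul_pos {P : ℝ[X]} (hP : P.natDegree ≠ 0) {u v : ℝ}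
    (hu : (P - C u).Splits) (hv : (P - C v).Splits) {t : ℝ}
    (h : 0 < (P.eval t - u) * (P.eval t - v)) : rootCount P u t = rootCount P v t := by
  have h1 := rootCount_le_succ hP (u := u) hv t
  have h2 := rootCount_le_succ hP (u := v) hu t
  have hl : ∀ u, (P - C u).leadingCoeff = P.leadingCoeff := fun u => by
    rw [leadingCoeff, natDegree_sub_C, coeff_sub, coeff_C_of_ne_zero hP, sub_zero, leadingCoeff]
  have hut : (P - C u).eval t ≠ 0 := by
    rw [eval_sub, eval_C]; exact left_ne_zero_of_mul h.ne'
  have hvt : (P - C v).eval t ≠ 0 := by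
    rw [eval_sub, eval_C]; exact right_ne_zero_of_mul h.ne'
  have h3 := eval_mul_neg_one_pow_pos hu t hut
  have h4 := eval_mul_neg_one_pow_pos hv t hvt
  have cu : (P - C u).roots.card = P.natDegree := by
    rw [← hu.natDegree_eq_card_roots, natDegree_sub_C]
  have cv : (P - C v).roots.card = P.natDegree := by
    rw [← hv.natDegree_eq_card_roots, natDegree_sub_C]
  have h5 := Multiset.card_add (Multiset.filter (· ≤ t) (P - C v).roots)
    (Multiset.filter (fun x => ¬ x ≤ t) (P - C v).roots)
  have h6 := Multiset.card_add (Multiset.filter (· ≤ t) (P - C u).roots)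
    (Multiset.filter (fun x => ¬ x ≤ t) (P - C u).roots)
  rw [Multiset.filter_add_not] at h5 h6
  rw [hl, eval_sub, eval_C] at h3 h4
  set k := ((P - C u).roots.filter (fun x => ¬ x ≤ t)).card
  set l := ((P - C v).roots.filter (fun x => ¬ x ≤ t)).card
  have h7 : 0 < (-1 : ℝ) ^ (k + l) := by
    have h8 := mul_pos h3 h4
    have h9 : P.leadingCoeff * (-1) ^ k * (P.eval t - u) *
        (P.leadingCoeff * (-1) ^ l * (P.eval t - v)) =
        (P.leadingCoeff ^ 2 * ((P.eval t - u) * (P.eval t - v))) * (-1) ^ (k + l) := by ring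
    rw [h9] at h8
    exact pos_of_mul_pos_right h8 (by positivity)
  have h10 : Even (k + l) := by
    by_contra hodd
    rw [Nat.not_even_iff_odd] at hodd
    rw [hodd.neg_one_pow] at h7
    linarith
  obtain ⟨j, hj⟩ := h10
  unfold rootCount at *
  omega

/-! ### Iterates -/

theorem natDegree_polyIter (R : ℝ[X]) (n : ℕ) : (polyIter R n).natDegree = R.natDegree ^ n := by
  induction n with
  | zero => simp [polyIter]
  | succ n ih => rw [polyIter, natDegree_comp, ih, pow_succ']

theorem polyIter_succ_comp (R : ℝ[X]) (n : ℕ) : polyIter R (n + 1) = (polyIter R n).comp R := by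
  induction n with
  | zero => simp [polyIter]
  | succ n ih =>
    conv_lhs => rw [polyIter, ih, ← comp_assoc]
    rw [polyIter]

theorem memIcc_ofReal {a x : ℝ} : memIcc a x ↔ x ∈ Set.Icc 0 a := by
  simp [memIcc]

theorem memIcc_of_aeval_polyIter {R : ℝ[X]} {a : ℝ}
    (hinv : ∀ z : ℂ, memIcc a (aeval z R) → memIcc a z) (n : ℕ) (z : ℂ)
    (hz : memIcc a (aeval z (polyIter R n))) : memIcc a z := by
  induction n with
  | zero => simpa [polyIter] using hz
  | succ n ih =>
    rw [polyIter, aeval_comp] at hz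
    exact ih (hinv _ hz)

section Level

variable {R : ℝ[X]} {a : ℝ} (hinv : ∀ z : ℂ, memIcc a (aeval z R) → memIcc a z)
include hinv

theorem splits_polyIter_sub_C (n : ℕ) {u : ℝ} (hu : u ∈ Set.Icc 0 a) :
    (polyIter R n - C u).Splits := by
  refine splits_of_complex_roots_real fun z hz => ?_
  have h : aeval z (polyIter R n) = (u : ℂ) := by
    simpa [sub_eq_zero] using hz
  exact (memIcc_of_aeval_polyIter hinv n z (h ▸ memIcc_ofReal.2 hu)).1

theorem mem_Icc_of_mem_roots (n : ℕ) {u x : ℝ} (hu : u ∈ Set.Icc 0 a)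
    (hx : x ∈ (polyIter R n - C u).roots) : x ∈ Set.Icc 0 a := by
  have h := (mem_roots'.1 hx).2
  rw [IsRoot, eval_sub, eval_C, sub_eq_zero] at h
  refine memIcc_ofReal.1 (memIcc_of_aeval_polyIter hinv n x ?_)
  rw [show (x : ℂ) = algebraMap ℝ ℂ x from rfl, aeval_algebraMap_apply, aeval_def,
    eval₂_eq_eval_map]
  simpa [h] using memIcc_ofReal.2 hu

theorem card_roots_polyIter (n : ℕ) {u : ℝ} (hu : u ∈ Set.Icc 0 a) :
    (polyIter R n - C u).roots.card = R.natDegree ^ n := by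
  rw [← (splits_polyIter_sub_C hinv n hu).natDegree_eq_card_roots, natDegree_sub_C,
    natDegree_polyIter]

/-- The roots at level `n + 1` are the preimages of those at level `n`. -/
theorem roots_polyIter_succ (hR : R.natDegree ≠ 0) (n : ℕ) {u : ℝ} (hu : u ∈ Set.Icc 0 a) :
    (polyIter R (n + 1) - C u).roots =
      (polyIter R n - C u).roots.bind fun y => (R - C y).roots := by
  rw [← roots_comp_of_splits (splits_polyIter_sub_C hinv n hu) hR, sub_comp, C_comp,
    ← polyIter_succ_comp]

theorem roots_polyIter_succ' (hR : R.natDegree ≠ 0) (n : ℕ) {u : ℝ} (hu : u ∈ Set.Icc 0 a) :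
    (polyIter R (n + 1) - C u).roots =
      (R - C u).roots.bind fun y => (polyIter R n - C y).roots := by
  have h : (R - C u).Splits := by
    simpa [polyIter] using splits_polyIter_sub_C hinv 1 hu
  rw [← roots_comp_of_splits h, sub_comp, C_comp, polyIter]
  rw [natDegree_polyIter]
  exact pow_ne_zero _ hR

theorem preimageRoots_eq_map (n : ℕ) {u : ℝ} (hu : u ∈ Set.Icc 0 a) :
    preimageRoots R u n = (polyIter R n - C u).roots.map ((↑) : ℝ → ℂ) :=
  (splits_polyIter_sub_C hinv n hu).roots_map (algebraMap ℝ ℂ)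

end Level

/-! ### Sums of Lipschitz functions over roots -/

open Set in
theorem indicator_integral_deriv {g : ℝ → ℝ} {L : NNReal} (hg : LipschitzWith L g) {a x : ℝ}
    (hx : x ∈ Icc 0 a) :
    IntegrableOn ((Ici x).indicator (deriv g)) (Ioc 0 a) ∧
      ∫ t in Ioc 0 a, (Ici x).indicator (deriv g) t = g a - g x := by
  have hac : ∀ u v : ℝ, AbsolutelyContinuousOnInterval g u v := fun u v =>
    hg.lipschitzOnWith.absolutelyContinuousOnInterval
  have hderiv := (hac 0 a).intervalIntegrable_deriv
  rw [intervalIntegrable_iff_integrableOn_Ioc_of_le (hx.1.trans hx.2)] at hderiv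
  refine ⟨hderiv.indicator measurableSet_Ici, ?_⟩
  rw [← (hac x a).integral_deriv_eq_sub, intervalIntegral.integral_of_le hx.2,
    setIntegral_indicator measurableSet_Ici, ← integral_Icc_eq_integral_Ioc]
  rcases hx.1.eq_or_lt with h | h
  · rw [← h, inter_eq_left.2 fun t ht => mem_Ici.2 ht.1.le, integral_Icc_eq_integral_Ioc]
  · congr 2
    ext t
    simp only [mem_inter_iff, mem_Ioc, mem_Ici, mem_Icc]
    constructor
    · rintro ⟨⟨_, h2⟩, h3⟩
      exact ⟨h3, h2⟩
    · rintro ⟨h2, h3⟩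
      exact ⟨⟨h.trans_le h2, h3⟩, h2⟩

open Set in
theorem sum_eq_sub_integral_card_filter {g : ℝ → ℝ} {L : NNReal} (hg : LipschitzWith L g) {a : ℝ}
    (m : Multiset ℝ) (hm : ∀ x ∈ m, x ∈ Icc 0 a) :
    IntegrableOn (fun t => ((m.filter (· ≤ t)).card : ℝ) * deriv g t) (Ioc 0 a) ∧
      (m.map g).sum = m.card * g a -
        ∫ t in Ioc 0 a, ((m.filter (· ≤ t)).card : ℝ) * deriv g t := by
  induction m using Multiset.induction_on with
  | empty => simp
  | cons x m ih =>
    obtain ⟨h1, h2⟩ := ih fun y hy => hm y (Multiset.mem_cons_of_mem hy)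
    obtain ⟨h3, h4⟩ := indicator_integral_deriv hg (hm x (Multiset.mem_cons_self _ _))
    have h5 : (fun t => ((((x ::ₘ m).filter (· ≤ t)).card : ℕ) : ℝ) * deriv g t) =
        fun t => (Ici x).indicator (deriv g) t + ((m.filter (· ≤ t)).card : ℝ) * deriv g t := by
      funext t
      by_cases h : x ≤ t
      · rw [Multiset.filter_cons_of_pos (p := (· ≤ t)) _ h, indicator_of_mem (mem_Ici.2 h), Multiset.card_cons]
        push_cast
        ring
      · rw [Multiset.filter_cons_of_neg (p := (· ≤ t)) _ h, indicator_of_notMem (by simpa using h), zero_add]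
    rw [h5]
    refine ⟨h3.add h1, ?_⟩
    rw [integral_add h3 h1, h4, Multiset.map_cons, Multiset.sum_cons, h2, Multiset.card_cons]
    push_cast
    ring

open Set in
theorem abs_sum_roots_sub_le {P : ℝ[X]} (hP : P.natDegree ≠ 0) {a u v M : ℝ} (hM : 0 ≤ M)
    (hu : u ∈ Icc 0 a) (hv : v ∈ Icc 0 a)
    (hsu : (P - C u).Splits) (hsv : (P - C v).Splits)
    (hru : ∀ x ∈ (P - C u).roots, x ∈ Icc 0 a) (hrv : ∀ x ∈ (P - C v).roots, x ∈ Icc 0 a)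
    (hE : volume {x : ℝ | x ∈ Icc 0 a ∧ P.eval x ∈ Icc 0 a} ≤ ENNReal.ofReal M)
    {g : ℝ → ℝ} {L : NNReal} (hg : LipschitzWith L g) :
    |((P - C u).roots.map g).sum - ((P - C v).roots.map g).sum| ≤ L * M := by
  obtain ⟨hu1, hu2⟩ := sum_eq_sub_integral_card_filter hg _ hru
  obtain ⟨hv1, hv2⟩ := sum_eq_sub_integral_card_filter hg _ hrv
  rw [hu2, hv2, ← hsu.natDegree_eq_card_roots, ← hsv.natDegree_eq_card_roots, natDegree_sub_C,
    natDegree_sub_C, sub_sub_sub_cancel_left, ← integral_sub hv1 hu1]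
  set E := {x : ℝ | x ∈ Icc 0 a ∧ P.eval x ∈ Icc 0 a} with hEdef
  set F : ℝ → ℝ := fun t => (rootCount P v t : ℝ) * deriv g t - (rootCount P u t : ℝ) * deriv g t
    with hF
  have hF0 : ∀ t ∈ Ioc 0 a \ (Ioc 0 a ∩ E), F t = 0 := by
    rintro t ⟨ht, htE⟩
    have hmul : 0 < (P.eval t - u) * (P.eval t - v) := by
      have h1 : P.eval t ∉ Icc 0 a := fun h => htE ⟨ht, ⟨ht.1.le, ht.2⟩, h⟩
      rw [mem_Icc, not_and_or, not_le, not_le] at h1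
      rcases h1 with h1 | h1
      · exact mul_pos_of_neg_of_neg (by linarith [hu.1]) (by linarith [hv.1])
      · exact mul_pos (by linarith [hu.2]) (by linarith [hv.2])
    simp only [hF, rootCount_eq_of_mul_pos hP hsu hsv hmul, sub_self]
  have hFb : ∀ t, ‖F t‖ ≤ L := fun t => by
    have h1 := rootCount_le_succ hP (u := u) hsv t
    have h2 := rootCount_le_succ hP (u := v) hsu t
    have h3 : |(rootCount P v t : ℝ) - rootCount P u t| ≤ 1 := by
      have h1' : (rootCount P u t : ℝ) ≤ rootCount P v t + 1 := by exact_mod_cast h1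
      have h2' : (rootCount P v t : ℝ) ≤ rootCount P u t + 1 := by exact_mod_cast h2
      rw [abs_le]
      constructor <;> linarith
    simp only [hF, ← sub_mul, norm_mul, Real.norm_eq_abs]
    have h4 := norm_deriv_le_of_lipschitz hg (x₀ := t)
    rw [Real.norm_eq_abs] at h4
    calc _ ≤ 1 * (L : ℝ) := mul_le_mul h3 h4 (abs_nonneg _) zero_le_one
      _ = L := one_mul _
  change |∫ t in Ioc 0 a, F t| ≤ _
  rw [setIntegral_eq_of_subset_of_forall_sdiff_eq_zero measurableSet_Ioc
    inter_subset_left hF0]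
  have hvol : volume (Ioc 0 a ∩ E) ≤ ENNReal.ofReal M := (measure_mono inter_subset_right).trans hE
  have h := norm_setIntegral_le_of_norm_le_const (f := F) (C := (L : ℝ))
    (hvol.trans_lt ENNReal.ofReal_lt_top) (fun t _ => hFb t)
  rw [Real.norm_eq_abs] at h
  refine h.trans (mul_le_mul_of_nonneg_left ?_ L.2)
  exact ENNReal.toReal_le_of_le_ofReal hM hvol

open Set in
theorem norm_sum_roots_sub_le {P : ℝ[X]} (hP : P.natDegree ≠ 0) {a u v M : ℝ} (hM : 0 ≤ M)
    (hu : u ∈ Icc 0 a) (hv : v ∈ Icc 0 a)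
    (hsu : (P - C u).Splits) (hsv : (P - C v).Splits)
    (hru : ∀ x ∈ (P - C u).roots, x ∈ Icc 0 a) (hrv : ∀ x ∈ (P - C v).roots, x ∈ Icc 0 a)
    (hE : volume {x : ℝ | x ∈ Icc 0 a ∧ P.eval x ∈ Icc 0 a} ≤ ENNReal.ofReal M)
    {g : ℝ → ℂ} {L : NNReal} (hg : LipschitzWith L g) :
    ‖((P - C u).roots.map g).sum - ((P - C v).roots.map g).sum‖ ≤ 2 * (L * M) := by
  have hre : LipschitzWith L fun x => (g x).re := by
    refine LipschitzWith.of_dist_le_mul fun x y => ?_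
    rw [Real.dist_eq, ← Complex.sub_re]
    exact (Complex.abs_re_le_norm _).trans (by simpa [dist_eq_norm] using hg.dist_le_mul x y)
  have him : LipschitzWith L fun x => (g x).im := by
    refine LipschitzWith.of_dist_le_mul fun x y => ?_
    rw [Real.dist_eq, ← Complex.sub_im]
    exact (Complex.abs_im_le_norm _).trans (by simpa [dist_eq_norm] using hg.dist_le_mul x y)
  have sre : ∀ m : Multiset ℝ, ((m.map g).sum).re = (m.map fun x => (g x).re).sum := fun m => by
    simpa [Multiset.map_map, Function.comp_def] using map_multiset_sum Complex.reLm (m.map g)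
  have sim : ∀ m : Multiset ℝ, ((m.map g).sum).im = (m.map fun x => (g x).im).sum := fun m => by
    simpa [Multiset.map_map, Function.comp_def] using map_multiset_sum Complex.imLm (m.map g)
  have h1 := abs_sum_roots_sub_le hP hM hu hv hsu hsv hru hrv hE hre
  have h2 := abs_sum_roots_sub_le hP hM hu hv hsu hsv hru hrv hE him
  rw [← sre, ← sre, ← Complex.sub_re] at h1
  rw [← sim, ← sim, ← Complex.sub_im] at h2
  linarith [Complex.norm_le_abs_re_add_abs_im
    (((P - C u).roots.map g).sum - ((P - C v).roots.map g).sum)]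

/-! ### The inverse branch at the fixed point `0` -/

/-- The standing assumptions on the polynomial `R`. -/
structure Admissible (R : ℝ[X]) (c a : ℝ) : Prop where
  two_le : 2 ≤ R.natDegree
  eval_zero : R.eval 0 = 0
  eval_derivative : R.derivative.eval 0 = c
  one_lt : 1 < c
  pos : 0 < a
  inv : ∀ z : ℂ, memIcc a (aeval z R) → memIcc a z

/-- `f` is the inverse branch of `R` on `[0, a]` fixing `0`; it takes values in `[0, b]` and all
other branches take values in `[b, a]`. -/
structure IsBranch (R : ℝ[X]) (a b : ℝ) (f : ℝ → ℝ) : Prop where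
  pos : 0 < b
  lt : b < a
  mapsTo : Set.MapsTo f (Set.Icc 0 a) (Set.Icc 0 b)
  eval_apply : ∀ y ∈ Set.Icc 0 a, R.eval (f y) = y
  eval_mem : ∀ x ∈ Set.Icc 0 b, R.eval x ∈ Set.Icc 0 a
  strictMonoOn : StrictMonoOn (fun x => R.eval x) (Set.Icc 0 b)
  roots : ∀ y ∈ Set.Icc 0 a, ∃ M : Multiset ℝ,
    (R - C y).roots = f y ::ₘ M ∧ ∀ x ∈ M, x ∈ Set.Icc b a
  apply_right : f a = b

section Admissible

variable {R : ℝ[X]} {c a : ℝ}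

theorem Admissible.natDegree_ne_zero (h : Admissible R c a) : R.natDegree ≠ 0 := by
  have := h.two_le
  omega

theorem Admissible.splits (h : Admissible R c a) {u : ℝ} (hu : u ∈ Set.Icc 0 a) :
    (R - C u).Splits := by
  simpa [polyIter] using splits_polyIter_sub_C h.inv 1 hu

theorem Admissible.mem_Icc (h : Admissible R c a) {u x : ℝ} (hu : u ∈ Set.Icc 0 a)
    (hx : x ∈ (R - C u).roots) : x ∈ Set.Icc 0 a :=
  mem_Icc_of_mem_roots h.inv 1 hu (by simpa [polyIter] using hx)

theorem Admissible.card_roots (h : Admissible R c a) {u : ℝ} (hu : u ∈ Set.Icc 0 a) :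
    (R - C u).roots.card = R.natDegree := by
  simpa [polyIter] using card_roots_polyIter h.inv 1 hu

theorem Admissible.mem_roots (h : Admissible R c a) {u x : ℝ} :
    x ∈ (R - C u).roots ↔ R.eval x = u := by
  have : R - C u ≠ 0 := fun h0 => h.natDegree_ne_zero (by rw [sub_eq_zero.1 h0, natDegree_C])
  rw [Polynomial.mem_roots this, IsRoot, eval_sub, eval_C, sub_eq_zero]

open Set in
theorem Admissible.exists_isBranch (h : Admissible R c a) : ∃ b f, IsBranch R a b f := by
  have h0a : (0 : ℝ) ∈ Icc 0 a := ⟨le_rfl, h.pos.le⟩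
  have haa : a ∈ Icc 0 a := ⟨h.pos.le, le_rfl⟩
  have hne : (R - C a).roots.toFinset.Nonempty := by
    rw [Multiset.toFinset_nonempty]
    intro h0
    have := h.card_roots haa
    rw [h0, Multiset.card_zero] at this
    exact h.natDegree_ne_zero this.symm
  set b := (R - C a).roots.toFinset.min' hne with hb
  have hbmem : b ∈ (R - C a).roots := Multiset.mem_toFinset.1 (Finset.min'_mem _ _)
  have hRb : R.eval b = a := h.mem_roots.1 hbmem
  have hbIcc := h.mem_Icc haa hbmem
  have hbmin : ∀ x, R.eval x = a → b ≤ x := fun x hx =>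
    Finset.min'_le _ _ (Multiset.mem_toFinset.2 (h.mem_roots.2 hx))
  have hb0 : 0 < b := by
    refine hbIcc.1.lt_of_ne fun h0 => ?_
    rw [← h0, h.eval_zero] at hRb
    exact h.pos.ne hRb
  have hcont : ∀ s, ContinuousOn (fun x => R.eval x) s := fun s => R.continuous.continuousOn
  have hcount : ∀ u, ∀ t < b, rootCount R u t ≤ 1 := fun u t ht => by
    have h1 := rootCount_le_succ h.natDegree_ne_zero (u := u) (h.splits haa) t
    have h2 : rootCount R a t = 0 := by
      rw [rootCount, Multiset.card_eq_zero, Multiset.filter_eq_nil]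
      exact fun x hx => not_le.2 (ht.trans_le (hbmin x (h.mem_roots.1 hx)))
    omega
  have hstruct : ∀ y ∈ Icc 0 a, ∃ x ∈ Icc 0 b, R.eval x = y ∧ ∃ M : Multiset ℝ,
      (R - C y).roots = x ::ₘ M ∧ ∀ r ∈ M, r ∈ Icc b a := by
    intro y hy
    obtain ⟨x, hx, hxy⟩ : y ∈ (fun x => R.eval x) '' Icc 0 b := by
      refine intermediate_value_Icc hb0.le (hcont _) ?_
      simpa [h.eval_zero, hRb] using hy
    obtain ⟨M, hM⟩ := Multiset.exists_cons_of_mem (h.mem_roots.2 hxy)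
    refine ⟨x, hx, hxy, M, hM, fun r hr => ?_⟩
    have hrr : r ∈ (R - C y).roots := hM ▸ Multiset.mem_cons_of_mem hr
    refine ⟨?_, (h.mem_Icc hy hrr).2⟩
    by_contra! hrb
    have hxb : x < b := by
      refine hx.2.lt_of_ne fun hxb => ?_
      have : y = a := by rw [← hxy, hxb]; exact hRb
      exact absurd (hbmin r (by rw [← this]; exact h.mem_roots.1 hrr)) (not_le.2 hrb)
    have h1 := hcount y (max x r) (max_lt hxb hrb)
    obtain ⟨M', rfl⟩ := Multiset.exists_cons_of_mem hr
    rw [rootCount, hM, Multiset.filter_cons_of_pos (p := (· ≤ max x r)) _ (le_max_left _ _),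
      Multiset.filter_cons_of_pos (p := (· ≤ max x r)) _ (le_max_right _ _), Multiset.card_cons,
      Multiset.card_cons] at h1
    omega
  have huniq : ∀ y ∈ Icc 0 a, ∀ x ∈ Icc 0 b, ∀ x' ∈ Icc 0 b, R.eval x = y → R.eval x' = y →
      x = x' := by
    intro y hy
    obtain ⟨w, hw, hwy, M, hM, hMb⟩ := hstruct y hy
    have key : ∀ x ∈ Icc 0 b, R.eval x = y → x = w := by
      intro x hx hxy
      have h1 := h.mem_roots.2 hxy
      rw [hM, Multiset.mem_cons] at h1
      refine h1.elim id fun h2 => ?_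
      have hxb : x = b := le_antisymm hx.2 (hMb x h2).1
      have hya : y = a := by rw [← hxy, hxb, hRb]
      exact hxb.trans (le_antisymm (hbmin w (hwy.trans hya)) hw.2)
    intro x hx x' hx' h1 h2
    rw [key x hx h1, key x' hx' h2]
  have hmem : ∀ x ∈ Icc 0 b, R.eval x ∈ Icc 0 a := by
    intro x hx
    constructor
    · by_contra! hneg
      have hx0 : x ≠ 0 := by
        rintro rfl
        exact hneg.ne h.eval_zero
      obtain ⟨w, hw, hw0⟩ : (0 : ℝ) ∈ (fun x => R.eval x) '' Icc x b := by
        refine intermediate_value_Icc hx.2 (hcont _) ⟨hneg.le, ?_⟩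
        simpa [hRb] using h.pos.le
      have := huniq 0 h0a w ⟨hx.1.trans hw.1, hw.2⟩ 0 ⟨le_rfl, hb0.le⟩ hw0 h.eval_zero
      exact hx0 (le_antisymm (this ▸ hw.1) hx.1)
    · by_contra! hgt
      obtain ⟨w, hw, hwa⟩ : a ∈ (fun x => R.eval x) '' Icc 0 x := by
        refine intermediate_value_Icc hx.1 (hcont _) ⟨?_, hgt.le⟩
        simpa [h.eval_zero] using h.pos.le
      have h1 := hbmin w hwa
      have h2 : x = b := le_antisymm hx.2 (h1.trans hw.2)
      rw [h2, hRb] at hgt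
      exact lt_irrefl _ hgt
  have hinj : InjOn (fun x => R.eval x) (Icc 0 b) := fun x hx x' hx' hxx' =>
    huniq _ (hmem x hx) x hx x' hx' rfl hxx'.symm
  have hmono : StrictMonoOn (fun x => R.eval x) (Icc 0 b) :=
    (hcont _).strictMonoOn_of_injOn_Icc hb0.le
      (by simpa [h.eval_zero, hRb] using h.pos.le) hinj
  have hba : b < a := by
    refine hbIcc.2.lt_of_ne fun hba => ?_
    obtain ⟨x, hx, hx0, M, hM, hMb⟩ := hstruct 0 h0a
    have h1 := h.card_roots h0a
    rw [hM, Multiset.card_cons] at h1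
    have h2 : 0 < M.card := by have := h.two_le; omega
    obtain ⟨r, hr⟩ := Multiset.card_pos_iff_exists_mem.1 h2
    have h3 : R.eval r = 0 := h.mem_roots.1 (hM ▸ Multiset.mem_cons_of_mem hr)
    have h4 : r = b := le_antisymm ((hMb r hr).2.trans hba.ge) (hMb r hr).1
    rw [h4, hRb] at h3
    exact h.pos.ne' h3
  choose! f hf1 hf2 M hf3 hf4 using hstruct
  refine ⟨b, f, hb0, hba, hf1, hf2, hmem, hmono, fun y hy => ⟨M y, hf3 y hy, hf4 y hy⟩, ?_⟩
  exact huniq a haa _ (hf1 a haa) b ⟨hb0.le, le_rfl⟩ (hf2 a haa) hRb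

variable {b : ℝ} {f : ℝ → ℝ}

open Set

theorem IsBranch.mem_Icc (hf : IsBranch R a b f) {y : ℝ} (hy : y ∈ Icc 0 a) : f y ∈ Icc 0 a :=
  ⟨(hf.mapsTo hy).1, (hf.mapsTo hy).2.trans hf.lt.le⟩

theorem IsBranch.apply_eval (hf : IsBranch R a b f) {x : ℝ} (hx : x ∈ Icc 0 b) :
    f (R.eval x) = x :=
  hf.strictMonoOn.injOn (hf.mapsTo (hf.eval_mem x hx)) hx (hf.eval_apply _ (hf.eval_mem x hx))

theorem IsBranch.strictMonoOn_branch (hf : IsBranch R a b f) : StrictMonoOn f (Icc 0 a) := by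
  intro x hx y hy hxy
  rw [← hf.strictMonoOn.lt_iff_lt (hf.mapsTo hx) (hf.mapsTo hy)]
  simpa only [hf.eval_apply x hx, hf.eval_apply y hy] using hxy

theorem IsBranch.apply_zero (hf : IsBranch R a b f) (h : Admissible R c a) : f 0 = 0 := by
  have := hf.apply_eval (x := 0) ⟨le_rfl, hf.pos.le⟩
  rwa [h.eval_zero] at this

theorem abs_prod_map_sub_le {b y z : ℝ} (hyz : y ≤ z) (hz : z ≤ b) (M : Multiset ℝ)
    (hM : ∀ r ∈ M, b ≤ r) : |(M.map (z - ·)).prod| ≤ |(M.map (y - ·)).prod| := by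
  induction M using Multiset.induction_on with
  | empty => simp
  | cons r M ih =>
    have h1 := ih fun x hx => hM x (Multiset.mem_cons_of_mem hx)
    have h2 := hM r (Multiset.mem_cons_self _ _)
    simp only [Multiset.map_cons, Multiset.prod_cons, abs_mul]
    refine mul_le_mul ?_ h1 (abs_nonneg _) (abs_nonneg _)
    rw [abs_of_nonpos (by linarith), abs_of_nonpos (by linarith)]
    linarith

theorem IsBranch.concaveOn (hf : IsBranch R a b f) (h : Admissible R c a) :
    ConcaveOn ℝ (Icc 0 b) fun x => R.eval x := by
  refine concaveOn_of_slope_anti_adjacent (convex_Icc _ _) fun {x y z} hx hz hxy hyz => ?_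
  have hy : y ∈ Icc 0 b := ⟨hx.1.trans hxy.le, hyz.le.trans hz.2⟩
  have hw := hf.eval_mem x hx
  obtain ⟨M, hM, hMb⟩ := hf.roots _ hw
  rw [hf.apply_eval hx] at hM
  have hfac : ∀ t, R.eval t - R.eval x =
      (t - x) * ((R - C (R.eval x)).leadingCoeff * (M.map (t - ·)).prod) := fun t => by
    have h1 := (h.splits hw).eval_eq_prod_roots t
    rw [hM, Multiset.map_cons, Multiset.prod_cons, eval_sub, eval_C] at h1
    rw [h1]
    ring
  have hRy : R.eval x < R.eval y := hf.strictMonoOn hx hy hxy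
  have hRz : R.eval x < R.eval z := hf.strictMonoOn hx hz (hxy.trans hyz)
  set A := (R - C (R.eval x)).leadingCoeff * (M.map (y - ·)).prod with hA
  set B := (R - C (R.eval x)).leadingCoeff * (M.map (z - ·)).prod with hB
  have hy' : R.eval y - R.eval x = (y - x) * A := hfac y
  have hz' : R.eval z - R.eval x = (z - x) * B := hfac z
  have hApos : 0 < A := by
    refine pos_of_mul_pos_right (a := y - x) ?_ (sub_pos.2 hxy).le
    rw [← hy']
    exact sub_pos.2 hRy
  have hBpos : 0 < B := by
    refine pos_of_mul_pos_right (a := z - x) ?_ (sub_pos.2 (hxy.trans hyz)).le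
    rw [← hz']
    exact sub_pos.2 hRz
  have hBA : B ≤ A := by
    rw [← abs_of_pos hApos, ← abs_of_pos hBpos, hA, hB, abs_mul, abs_mul]
    exact mul_le_mul_of_nonneg_left
      (abs_prod_map_sub_le hyz.le hz.2 M fun r hr => (hMb r hr).1) (abs_nonneg _)
  rw [div_le_div_iff₀ (sub_pos.2 hyz) (sub_pos.2 hxy)]
  nlinarith [mul_nonneg (mul_nonneg (sub_pos.2 hxy).le (sub_pos.2 (hxy.trans hyz)).le)
    (sub_nonneg.2 hBA)]

theorem IsBranch.convexOn (hf : IsBranch R a b f) (h : Admissible R c a) :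
    ConvexOn ℝ (Icc 0 a) f := by
  refine ⟨convex_Icc _ _, fun x hx y hy s t hs ht hst => ?_⟩
  have hxy := convex_Icc _ _ hx hy hs ht hst
  have hfx := hf.mapsTo hx
  have hfy := hf.mapsTo hy
  rw [← hf.strictMonoOn.le_iff_le (hf.mapsTo hxy) (convex_Icc _ _ hfx hfy hs ht hst)]
  have h1 := (hf.concaveOn h).2 hfx hfy hs ht hst
  simp only [hf.eval_apply x hx, hf.eval_apply y hy] at h1
  simpa only [hf.eval_apply _ hxy] using h1

theorem IsBranch.mapsTo_iterate (hf : IsBranch R a b f) (k : ℕ) :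
    MapsTo f^[k] (Icc 0 a) (Icc 0 a) :=
  MapsTo.iterate (fun _ hy => hf.mem_Icc hy) k

theorem IsBranch.monotoneOn_iterate (hf : IsBranch R a b f) (k : ℕ) :
    MonotoneOn f^[k] (Icc 0 a) := by
  induction k with
  | zero => exact monotone_id.monotoneOn _
  | succ k ih =>
    rw [Function.iterate_succ']
    exact hf.strictMonoOn_branch.monotoneOn.comp ih (hf.mapsTo_iterate k)

theorem IsBranch.convexOn_iterate (hf : IsBranch R a b f) (h : Admissible R c a) (k : ℕ) :
    ConvexOn ℝ (Icc 0 a) f^[k] := by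
  induction k with
  | zero => exact convexOn_id (convex_Icc _ _)
  | succ k ih =>
    refine ⟨convex_Icc _ _, fun x hx y hy s t hs ht hst => ?_⟩
    have hxy := convex_Icc _ _ hx hy hs ht hst
    have hkx := hf.mapsTo_iterate k hx
    have hky := hf.mapsTo_iterate k hy
    rw [Function.iterate_succ_apply', Function.iterate_succ_apply', Function.iterate_succ_apply']
    exact (hf.strictMonoOn_branch.monotoneOn (hf.mapsTo_iterate k hxy)
      (convex_Icc _ _ hkx hky hs ht hst) (ih.2 hx hy hs ht hst)).trans
      ((hf.convexOn h).2 hkx hky hs ht hst)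

theorem IsBranch.apply_le (hf : IsBranch R a b f) (h : Admissible R c a) {y : ℝ}
    (hy : y ∈ Icc 0 a) : f y ≤ b / a * y := by
  have ha := h.pos
  have h1 := (hf.convexOn h).2 (⟨ha.le, le_rfl⟩ : a ∈ Icc 0 a) (⟨le_rfl, ha.le⟩ : 0 ∈ Icc 0 a)
    (div_nonneg hy.1 ha.le) (sub_nonneg.2 ((div_le_one ha).2 hy.2)) (by ring)
  simp only [smul_eq_mul, mul_zero, add_zero, hf.apply_zero h, hf.apply_right,
    div_mul_cancel₀ _ ha.ne'] at h1
  calc f y ≤ y / a * b := h1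
    _ = b / a * y := by ring

theorem IsBranch.iterate_le (hf : IsBranch R a b f) (h : Admissible R c a) (k : ℕ) {y : ℝ}
    (hy : y ∈ Icc 0 a) : f^[k] y ≤ (b / a) ^ k * y := by
  induction k with
  | zero => simp
  | succ k ih =>
    rw [Function.iterate_succ_apply']
    calc _ ≤ b / a * f^[k] y := hf.apply_le h (hf.mapsTo_iterate k hy)
      _ ≤ b / a * ((b / a) ^ k * y) :=
        mul_le_mul_of_nonneg_left ih (div_nonneg hf.pos.le h.pos.le)
      _ = _ := by ring

theorem IsBranch.abs_iterate_sub_le (hf : IsBranch R a b f) (h : Admissible R c a) (k : ℕ) {x y : ℝ}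
    (hx : x ∈ Icc 0 b) (hy : y ∈ Icc 0 b) :
    |f^[k] x - f^[k] y| ≤ (b / a) ^ k * (a / (a - b)) * |x - y| := by
  wlog hxy : x ≤ y generalizing x y
  · rw [abs_sub_comm, abs_sub_comm x]
    exact this hy hx (le_of_not_ge hxy)
  have hba := hf.lt
  have haa : a ∈ Icc 0 a := ⟨h.pos.le, le_rfl⟩
  have hxa : x ∈ Icc 0 a := ⟨hx.1, hx.2.trans hba.le⟩
  have hya : y ∈ Icc 0 a := ⟨hy.1, hy.2.trans hba.le⟩
  have hm := hf.monotoneOn_iterate k hxa hya hxy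
  rw [abs_sub_comm, abs_sub_comm x, abs_of_nonneg (sub_nonneg.2 hm),
    abs_of_nonneg (sub_nonneg.2 hxy)]
  rcases hxy.eq_or_lt with rfl | hlt
  · simp
  have h1 := (hf.convexOn_iterate h k).slope_mono_adjacent hxa haa hlt (hy.2.trans_lt hba)
  have h2 : (f^[k] a - f^[k] y) / (a - y) ≤ (b / a) ^ k * a / (a - b) := by
    have h3 := hf.iterate_le h k haa
    have h4 := (hf.mapsTo_iterate k hya).1
    exact div_le_div₀ (h4.trans (hf.monotoneOn_iterate k hya haa hya.2) |>.trans h3)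
      (by linarith) (by linarith) (by linarith [hy.2])
  have h5 := (div_le_iff₀ (sub_pos.2 hlt)).1 (h1.trans h2)
  calc _ ≤ _ := h5
    _ = _ := by ring

end Admissible

section Linearizer

variable {R : ℝ[X]} {c a b : ℝ} {f : ℝ → ℝ}

open Set

theorem exists_log_lipschitz {q : ℝ[X]} {b : ℝ} (hq : ∀ x ∈ Icc 0 b, 1 ≤ q.eval x) :
    ∃ K : ℝ, 0 ≤ K ∧ ∀ x ∈ Icc 0 b, ∀ y ∈ Icc 0 b,
      |Real.log (q.eval x) - Real.log (q.eval y)| ≤ K * |x - y| := by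
  have hdiff : ContDiffOn ℝ 1 (fun x => Real.log (q.eval x)) (Icc 0 b) :=
    by
    have hq' : ContDiff ℝ 1 fun x => q.eval x := by simpa using q.contDiff_aeval (𝕜 := ℝ) 1
    exact hq'.contDiffOn.log fun x hx => (zero_lt_one.trans_le (hq x hx)).ne'
  obtain ⟨K, hK⟩ := hdiff.exists_lipschitzOnWith one_ne_zero (convex_Icc _ _) isCompact_Icc
  exact ⟨K, K.2, fun x hx y hy => by simpa [Real.dist_eq] using hK.dist_le_mul x hx y hy⟩

theorem Admissible.eval_eq_mul_divX (h : Admissible R c a) (x : ℝ) :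
    R.eval x = R.divX.eval x * x := by
  conv_lhs => rw [← divX_mul_X_add R]
  rw [coeff_zero_eq_eval_zero, h.eval_zero]
  simp

theorem Admissible.eval_zero_divX (h : Admissible R c a) : R.divX.eval 0 = c := by
  rw [← h.eval_derivative, ← coeff_zero_eq_eval_zero, ← coeff_zero_eq_eval_zero, coeff_divX,
    coeff_derivative]
  simp

theorem IsBranch.one_le_eval_divX (hf : IsBranch R a b f) (h : Admissible R c a) {x : ℝ}
    (hx : x ∈ Icc 0 b) : 1 ≤ R.divX.eval x := by
  rcases hx.1.eq_or_lt with rfl | hx0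
  · rw [h.eval_zero_divX]
    exact h.one_lt.le
  · have hy := hf.eval_mem x hx
    have h1 := hf.apply_le h hy
    rw [hf.apply_eval hx] at h1
    have h2 : x ≤ R.eval x := h1.trans <| mul_le_of_le_one_left hy.1 <|
      (div_le_one h.pos).2 hf.lt.le
    rw [h.eval_eq_mul_divX] at h2
    exact le_of_mul_le_mul_right (by simpa using h2) hx0

theorem IsBranch.apply_pos (hf : IsBranch R a b f) (h : Admissible R c a) {y : ℝ}
    (hy : y ∈ Ioc 0 a) : 0 < f y := by
  have := hf.strictMonoOn_branch ⟨le_rfl, h.pos.le⟩ (Ioc_subset_Icc_self hy) hy.1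
  rwa [hf.apply_zero h] at this

/-- The logarithm of the linearizing coordinate at the repelling fixed point `0`. -/
theorem IsBranch.exists_linearizer (hf : IsBranch R a b f) (h : Admissible R c a) :
    ∃ lam : ℝ → ℝ, ∃ K L : ℝ, 0 ≤ K ∧ 0 ≤ L ∧
      (∀ y ∈ Ioc 0 b, lam (f y) = lam y - Real.log c) ∧
      (∀ x ∈ Ioc 0 b, |lam x - Real.log x| ≤ K * x) ∧
      ∀ x ∈ Icc (f b) b, ∀ y ∈ Icc (f b) b, |lam x - lam y| ≤ L * |x - y| := by
  obtain ⟨K, hK0, hK⟩ := exists_log_lipschitz fun x hx => hf.one_le_eval_divX h hx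
  have ha := h.pos
  have hb := hf.pos
  have hba := hf.lt
  set ρ := b / a with hρ
  have hρ0 : 0 ≤ ρ := div_nonneg hb.le ha.le
  have hρ1 : ρ < 1 := (div_lt_one ha).2 hba
  have hgeo := summable_geometric_of_lt_one hρ0 hρ1
  have hIcc : ∀ {x}, x ∈ Icc 0 b → x ∈ Icc 0 a := fun hx => ⟨hx.1, hx.2.trans hba.le⟩
  set θ : ℝ → ℝ := fun x => Real.log c - Real.log (R.divX.eval x) with hθ
  have hθlip : ∀ x ∈ Icc 0 b, ∀ y ∈ Icc 0 b, |θ x - θ y| ≤ K * |x - y| := fun x hx y hy => by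
    have := hK y hy x hx
    rw [abs_sub_comm y x] at this
    simpa only [hθ, sub_sub_sub_cancel_left] using this
  have h0b : (0 : ℝ) ∈ Icc 0 b := ⟨le_rfl, hb.le⟩
  have hθ0 : θ 0 = 0 := by simp [hθ, h.eval_zero_divX]
  have hθle : ∀ x ∈ Icc 0 b, |θ x| ≤ K * x := fun x hx => by
    simpa [hθ0, abs_of_nonneg hx.1] using hθlip x hx 0 h0b
  have hiter : ∀ (k : ℕ) {x}, x ∈ Icc 0 a → f^[k + 1] x ∈ Icc 0 b := fun k x hx => by
    rw [Function.iterate_succ_apply']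
    exact hf.mapsTo (hf.mapsTo_iterate k hx)
  have hterm : ∀ x ∈ Icc 0 a, ∀ k : ℕ, |θ (f^[k + 1] x)| ≤ K * x * ρ ^ k := fun x hx k => by
    refine (hθle _ (hiter k hx)).trans ?_
    rw [mul_assoc]
    refine mul_le_mul_of_nonneg_left ((hf.iterate_le h (k + 1) hx).trans ?_) hK0
    rw [mul_comm x]
    exact mul_le_mul_of_nonneg_right
      (pow_le_pow_of_le_one hρ0 hρ1.le (Nat.le_succ k)) hx.1
  have hsum : ∀ x ∈ Icc 0 a, Summable fun k : ℕ => θ (f^[k + 1] x) := fun x hx =>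
    Summable.of_norm_bounded (hgeo.mul_left (K * x)) fun k => hterm x hx k
  set S : ℝ → ℝ := fun x => ∑' k : ℕ, θ (f^[k + 1] x) with hS
  have hSle : ∀ x ∈ Icc 0 a, |S x| ≤ K * (1 - ρ)⁻¹ * x := fun x hx => by
    have := tsum_of_norm_bounded (f := fun k : ℕ => θ (f^[k + 1] x))
      (hgeo.hasSum.mul_left (K * x)) fun k => hterm x hx k
    rw [tsum_geometric_of_lt_one hρ0 hρ1, Real.norm_eq_abs] at this
    calc _ ≤ _ := this
      _ = _ := by ring
  have hSlip : ∀ x ∈ Icc 0 b, ∀ y ∈ Icc 0 b,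
      |S x - S y| ≤ K * (a / (a - b)) * (1 - ρ)⁻¹ * |x - y| := fun x hx y hy => by
    have hxa := hIcc hx
    have hya := hIcc hy
    have h1 : ∀ k : ℕ, ‖θ (f^[k + 1] x) - θ (f^[k + 1] y)‖ ≤
        (K * (a / (a - b)) * |x - y|) * ρ ^ k := fun k => by
      refine (hθlip _ (hiter k hxa) _ (hiter k hya)).trans ?_
      have h2 := hf.abs_iterate_sub_le h (k + 1) hx hy
      have h3 : ρ ^ (k + 1) ≤ ρ ^ k := pow_le_pow_of_le_one hρ0 hρ1.le (Nat.le_succ k)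
      have h4 : 0 ≤ a / (a - b) := div_nonneg ha.le (by linarith)
      calc K * |f^[k + 1] x - f^[k + 1] y| ≤ K * (ρ ^ (k + 1) * (a / (a - b)) * |x - y|) :=
            mul_le_mul_of_nonneg_left h2 hK0
        _ ≤ K * (ρ ^ k * (a / (a - b)) * |x - y|) := by gcongr
        _ = _ := by ring
    have := tsum_of_norm_bounded (hgeo.hasSum.mul_left (K * (a / (a - b)) * |x - y|)) h1
    rw [tsum_geometric_of_lt_one hρ0 hρ1, (hsum x hxa).tsum_sub (hsum y hya),
      Real.norm_eq_abs] at this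
    calc _ ≤ _ := this
      _ = _ := by ring
  have hfb : 0 < f b := hf.apply_pos h ⟨hb, hba.le⟩
  refine ⟨fun x => Real.log x + S x, K * (1 - ρ)⁻¹,
    (f b)⁻¹ + K * (a / (a - b)) * (1 - ρ)⁻¹, ?_, ?_, ?_, ?_, ?_⟩
  · exact mul_nonneg hK0 (inv_nonneg.2 (sub_nonneg.2 hρ1.le))
  · exact add_nonneg (inv_nonneg.2 hfb.le) (mul_nonneg (mul_nonneg hK0
      (div_nonneg ha.le (by linarith))) (inv_nonneg.2 (sub_nonneg.2 hρ1.le)))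
  · intro y hy
    have hya : y ∈ Icc 0 a := hIcc (Ioc_subset_Icc_self hy)
    have hfy := hf.mapsTo hya
    have hfy0 : 0 < f y := hf.apply_pos h ⟨hy.1, hya.2⟩
    have h1 : S y = θ (f y) + S (f y) := by
      simp only [hS]
      rw [(hsum y hya).tsum_eq_zero_add]
      simp only [zero_add, Function.iterate_succ_apply, Function.iterate_zero_apply]
    have h2 : Real.log y = Real.log (R.divX.eval (f y)) + Real.log (f y) := by
      conv_lhs => rw [← hf.eval_apply y hya, h.eval_eq_mul_divX]
      exact Real.log_mul (zero_lt_one.trans_le (hf.one_le_eval_divX h hfy)).ne' hfy0.ne'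
    simp only [h1, h2, hθ]
    ring
  · intro x hx
    simpa using hSle x (hIcc (Ioc_subset_Icc_self hx))
  · intro x hx y hy
    have hxb : x ∈ Icc 0 b := ⟨hfb.le.trans hx.1, hx.2⟩
    have hyb : y ∈ Icc 0 b := ⟨hfb.le.trans hy.1, hy.2⟩
    have hlog : |Real.log x - Real.log y| ≤ (f b)⁻¹ * |x - y| := by
      have hd : ∀ t ∈ Icc (f b) b, DifferentiableAt ℝ Real.log t := fun t ht =>
        Real.differentiableAt_log (hfb.trans_le ht.1).ne'
      have := (convex_Icc (f b) b).norm_image_sub_le_of_norm_deriv_le (C := (f b)⁻¹) hd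
        (fun t ht => by
          rw [Real.deriv_log, norm_inv, Real.norm_of_nonneg (hfb.le.trans ht.1)]
          exact inv_anti₀ hfb ht.1) hy hx
      simpa only [Real.norm_eq_abs] using this
    have h1 := hSlip x hxb y hyb
    calc |Real.log x + S x - (Real.log y + S y)|
        = |(Real.log x - Real.log y) + (S x - S y)| := by congr 1; ring
      _ ≤ _ := abs_add_le _ _
      _ ≤ _ := by rw [add_mul]; exact add_le_add hlog h1

end Linearizer

/-! ### The regularized complex powers and their transfer relation -/

section Transfer

variable {R : ℝ[X]} {c a : ℝ}

open Set

/-- The function `x ↦ exp (-(s / 2) φ x)`, extended by zero at the origin. For `φ = log` this is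
the power `x ^ (-s / 2)`. -/
noncomputable def expTerm (φ : ℝ → ℝ) (s : ℂ) (x : ℝ) : ℂ :=
  if x = 0 then 0 else Complex.exp (-(s / 2) * φ x)

/-- The defect of the transfer relation for `expTerm`. -/
noncomputable def expDefect (l : ℝ → ℝ) (β : ℝ) (N : ℕ) (s : ℂ) (x : ℝ) : ℂ :=
  Complex.exp (-(s / 2) * l x) - Complex.exp (-(s / 2) * β) / N

/-- A replacement `lh` of the logarithm for which `expTerm` is an eigenfunction of the transfer
operator of `R`, up to a Lipschitz defect. -/
theorem Admissible.exists_transfer (h : Admissible R c a) :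
    ∃ (lh l : ℝ → ℝ) (β K B : ℝ) (L : NNReal), 0 ≤ K ∧
      (∀ x ∈ Ioc 0 a, |lh x - Real.log x| ≤ K * x) ∧ LipschitzWith L l ∧ (∀ x, |l x| ≤ B) ∧
      ∀ s : ℂ, ∀ y ∈ Icc 0 a,
        ((R - C y).roots.map (expTerm lh s)).sum =
          Complex.exp (s / 2 * Real.log c) * expTerm lh s y +
            ((R - C y).roots.map (expDefect l β R.natDegree s)).sum := by
  obtain ⟨b, f, hf⟩ := h.exists_isBranch
  obtain ⟨lam, K, L, hK, hL, hlam, hlog, hlip⟩ := hf.exists_linearizer h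
  have hb := hf.pos
  have ha := h.pos
  have hba := hf.lt
  have hfb : 0 < f b := hf.apply_pos h ⟨hb, hba.le⟩
  have hfbb : f b < b := by
    have := hf.strictMonoOn_branch ⟨hb.le, hba.le⟩ ⟨ha.le, le_rfl⟩ hba
    rwa [hf.apply_right] at this
  have hclamp : ∀ x, max (f b) (min x b) ∈ Icc (f b) b := fun x =>
    ⟨le_max_left _ _, max_le hfbb.le (min_le_right _ _)⟩
  have hcl : LipschitzWith 1 fun x : ℝ => max (f b) (min x b) :=
    (LipschitzWith.id.min_const b).const_max (f b)
  have hl : LipschitzWith ⟨L, hL⟩ fun x => lam (max (f b) (min x b)) := by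
    refine LipschitzWith.of_dist_le_mul fun x y => ?_
    rw [Real.dist_eq]
    refine (hlip _ (hclamp x) _ (hclamp y)).trans (mul_le_mul_of_nonneg_left ?_ hL)
    simpa [Real.dist_eq] using hcl.dist_le_mul x y
  set D := |lam b| + |Real.log b| + |Real.log a| with hD
  refine ⟨fun x => lam (min x b), fun x => lam (max (f b) (min x b)), lam (f b),
    K + D / b, |lam b| + L * b, ⟨L, hL⟩, ?_, ?_, hl, ?_, ?_⟩
  · positivity
  · intro x hx
    rcases le_or_gt x b with hxb | hxb
    · simp only [min_eq_left hxb]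
      refine (hlog x ⟨hx.1, hxb⟩).trans (mul_le_mul_of_nonneg_right ?_ hx.1.le)
      have : 0 ≤ D / b := by positivity
      linarith
    · simp only [min_eq_right hxb.le]
      have h1 : |Real.log x| ≤ |Real.log b| + |Real.log a| := by
        have h2 := Real.log_le_log hb hxb.le
        have h3 := Real.log_le_log hx.1 hx.2
        rw [abs_le]
        constructor
        · linarith [neg_abs_le (Real.log b), abs_nonneg (Real.log a)]
        · linarith [le_abs_self (Real.log a), abs_nonneg (Real.log b)]
      calc |lam b - Real.log x| ≤ |lam b| + |Real.log x| := abs_sub _ _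
        _ ≤ D := by linarith
        _ = D / b * b := by field_simp
        _ ≤ D / b * x := by gcongr
        _ ≤ (K + D / b) * x := by nlinarith [mul_nonneg hK hx.1.le]
  · intro x
    have h1 := hlip _ (hclamp x) b ⟨hfbb.le, le_rfl⟩
    have h2 : |max (f b) (min x b) - b| ≤ b := by
      rw [abs_le]
      constructor <;> linarith [(hclamp x).1, (hclamp x).2]
    have h3 := abs_sub_abs_le_abs_sub (lam (max (f b) (min x b))) (lam b)
    linarith [mul_le_mul_of_nonneg_left h2 hL]
  · intro s y hy
    obtain ⟨M, hM, hMb⟩ := hf.roots y hy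
    have hN : (R.natDegree : ℂ) ≠ 0 := Nat.cast_ne_zero.2 h.natDegree_ne_zero
    have hcard : M.card + 1 = R.natDegree := by
      rw [← h.card_roots hy, hM, Multiset.card_cons]
    have hM1 : M.map (expTerm (fun x => lam (min x b)) s) =
        M.map fun _ => Complex.exp (-(s / 2) * lam b) :=
      Multiset.map_congr rfl fun x hx => by
        have hbx := (hMb x hx).1
        simp [expTerm, min_eq_right hbx, (hb.trans_le hbx).ne']
    have hM2 : M.map (expDefect (fun x => lam (max (f b) (min x b))) (lam (f b)) R.natDegree s) =
        M.map fun _ => Complex.exp (-(s / 2) * lam b) -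
          Complex.exp (-(s / 2) * lam (f b)) / R.natDegree :=
      Multiset.map_congr rfl fun x hx => by
        have hbx := (hMb x hx).1
        simp [expDefect, min_eq_right hbx, max_eq_right hfbb.le]
    have hexp : ∀ t : ℝ, Complex.exp (-(s / 2) * ((t - Real.log c : ℝ) : ℂ)) =
        Complex.exp (s / 2 * Real.log c) * Complex.exp (-(s / 2) * t) := fun t => by
      rw [← Complex.exp_add]
      congr 1
      push_cast
      ring
    have key : expTerm (fun x => lam (min x b)) s (f y) =
        Complex.exp (s / 2 * Real.log c) * expTerm (fun x => lam (min x b)) s y +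
          (Complex.exp (-(s / 2) * lam (max (f b) (min (f y) b))) -
            Complex.exp (-(s / 2) * lam (f b))) := by
      rcases hy.1.eq_or_lt with rfl | hy0
      · simp [expTerm, hf.apply_zero h, min_eq_left hb.le, max_eq_left hfb.le]
      have hfy0 : 0 < f y := hf.apply_pos h ⟨hy0, hy.2⟩
      have hfyb : f y ≤ b := (hf.mapsTo hy).2
      rcases le_or_gt y b with hyb | hyb
      · have hle : f y ≤ f b := hf.strictMonoOn_branch.monotoneOn hy ⟨hb.le, hba.le⟩ hyb
        simp only [expTerm, hfy0.ne', hy0.ne', if_false, min_eq_left hfyb, min_eq_left hyb,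
          max_eq_left hle, hlam y ⟨hy0, hyb⟩, hexp, sub_self, add_zero]
      · have hle : f b ≤ f y := hf.strictMonoOn_branch.monotoneOn ⟨hb.le, hba.le⟩ hy hyb.le
        simp only [expTerm, hfy0.ne', hy0.ne', if_false, min_eq_left hfyb, min_eq_right hyb.le,
          max_eq_right hle, hlam b ⟨hb, le_rfl⟩, hexp]
        ring
    rw [hM, Multiset.map_cons, Multiset.sum_cons, Multiset.map_cons, Multiset.sum_cons, hM1, hM2,
      key, expDefect, Multiset.map_const', Multiset.map_const', Multiset.sum_replicate,
      Multiset.sum_replicate, nsmul_eq_mul, nsmul_eq_mul]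
    have hcard' : (M.card : ℂ) = R.natDegree - 1 := by
      rw [← hcard]
      push_cast
      ring
    rw [hcard']
    field_simp
    ring

end Transfer

/-! ### Continuation of a geometrically perturbed geometric series -/

section Continuation

open Set Topology

theorem exists_differentiable_limit {S : ℕ → ℂ → ℂ} {N r : ℝ} (hN : 1 ≤ N) (hr0 : 0 ≤ r)
    (hr1 : r < 1) (hS : ∀ n, Differentiable ℂ (S n))
    (hrec : ∀ ρ : ℝ, ∃ K : ℝ, ∀ s : ℂ, ‖s‖ < ρ → ∀ n, ‖S (n + 1) s - N * S n s‖ ≤ K * r ^ n) :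
    ∃ A : ℂ → ℂ, Differentiable ℂ A ∧
      ∀ ρ : ℝ, ∃ K : ℝ, ∀ s : ℂ, ‖s‖ < ρ → ∀ n, ‖S n s - N ^ n * A s‖ ≤ K * r ^ n := by
  have hN0 : 0 < N := zero_lt_one.trans_le hN
  have hNC : (N : ℂ) ≠ 0 := Complex.ofReal_ne_zero.2 hN0.ne'
  have hrN0 : 0 ≤ r / N := div_nonneg hr0 hN0.le
  have hrN : r / N < 1 := (div_lt_one hN0).2 (hr1.trans_le hN)
  set f : ℕ → ℂ → ℂ := fun n s => S n s / N ^ n with hf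
  set T : ℕ → ℂ → ℂ := fun n s => f (n + 1) s - f n s with hT
  have hTbound : ∀ {K : ℝ} {s : ℂ}, (∀ n, ‖S (n + 1) s - N * S n s‖ ≤ K * r ^ n) →
      ∀ n, ‖T n s‖ ≤ K / N * (r / N) ^ n := fun {K s} hK n => by
    have h1 : T n s = (S (n + 1) s - N * S n s) / N ^ (n + 1) := by
      simp only [hT, hf]
      field_simp
      ring
    rw [h1, norm_div, norm_pow, Complex.norm_real, Real.norm_of_nonneg hN0.le,
      div_le_iff₀ (by positivity)]
    refine (hK n).trans_eq ?_
    rw [div_pow, pow_succ (N : ℝ)]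
    field_simp
  have hgeo := summable_geometric_of_lt_one hrN0 hrN
  have hsum : ∀ s, Summable fun n => T n s := fun s => by
    obtain ⟨K, hK⟩ := hrec (‖s‖ + 1)
    exact Summable.of_norm_bounded (hgeo.mul_left (K / N)) (hTbound (hK s (lt_add_one _)))
  refine ⟨fun s => f 0 s + ∑' n, T n s, fun s => ?_, fun ρ => ?_⟩
  · obtain ⟨K, hK⟩ := hrec (‖s‖ + 1)
    have hd : ∀ n, Differentiable ℂ (f n) := fun n => (hS n).div_const _
    have hon : DifferentiableOn ℂ (fun s => ∑' n, T n s) (Metric.ball 0 (‖s‖ + 1)) :=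
      Complex.differentiableOn_tsum_of_summable_norm (hgeo.mul_left (K / N))
        (fun n => ((hd (n + 1)).sub (hd n)).differentiableOn) Metric.isOpen_ball
        fun n w hw => hTbound (hK w (mem_ball_zero_iff.1 hw)) n
    exact (hd 0 s).add (hon.differentiableAt
      (Metric.isOpen_ball.mem_nhds (mem_ball_zero_iff.2 (lt_add_one _))))
  · obtain ⟨K, hK⟩ := hrec ρ
    refine ⟨K / N / (1 - r / N), fun s hs n => ?_⟩
    have htend : Tendsto (fun n => f n s) atTop (𝓝 (f 0 s + ∑' n, T n s)) := by
      have := (hsum s).hasSum.tendsto_sum_nat.const_add (f 0 s)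
      refine this.congr fun n => ?_
      simp only [hT, Finset.sum_range_sub (fun n => f n s), add_sub_cancel]
    have hdist : ∀ n, dist (f n s) (f (n + 1) s) ≤ K / N * (r / N) ^ n := fun n => by
      rw [dist_comm, dist_eq_norm]
      exact hTbound (hK s hs) n
    have h1 := dist_le_of_le_geometric_of_tendsto (r / N) (K / N) hrN hdist htend n
    have h2 : S n s - N ^ n * (f 0 s + ∑' n, T n s) =
        N ^ n * (f n s - (f 0 s + ∑' n, T n s)) := by
      simp only [hf]
      field_simp
    rw [h2, norm_mul, norm_pow, Complex.norm_real, Real.norm_of_nonneg hN0.le, ← dist_eq_norm]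
    refine (mul_le_mul_of_nonneg_left h1 (by positivity)).trans_eq ?_
    rw [div_pow]
    field_simp

theorem exists_continuation_of_recurrence {q : ℂ → ℂ} {S G : ℕ → ℂ → ℂ} {N r : ℝ} (hN : 1 ≤ N)
    (hr0 : 0 < r) (hr1 : r < 1) (hq : Differentiable ℂ q) (hG0 : Differentiable ℂ (G 0))
    (hS : ∀ n, Differentiable ℂ (S n))
    (hrec : ∀ ρ : ℝ, ∃ K : ℝ, ∀ s : ℂ, ‖s‖ < ρ → ∀ n, ‖S (n + 1) s - N * S n s‖ ≤ K * r ^ n)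
    (hG : ∀ n s, G (n + 1) s = G n s + q s ^ (n + 1) * S (n + 1) s) :
    ∃ ξ ψ : ℂ → ℂ, Differentiable ℂ ξ ∧ DifferentiableOn ℂ ψ {s | ‖q s‖ * r < 1} ∧
      ∀ s, ‖q s‖ * N < 1 → Tendsto (fun n => G n s) atTop (𝓝 (ξ s / (1 - N * q s) + ψ s)) := by
  obtain ⟨A, hA, hSA⟩ := exists_differentiable_limit hN hr0.le hr1 hS hrec
  have hN0 : 0 < N := zero_lt_one.trans_le hN
  set e : ℕ → ℂ → ℂ := fun n s => q s ^ (n + 1) * (S (n + 1) s - N ^ (n + 1) * A s) with he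
  have hebound : ∀ {K t : ℝ} {s : ℂ}, ‖q s‖ ≤ t → (∀ n, ‖S n s - N ^ n * A s‖ ≤ K * r ^ n) →
      ∀ n, ‖e n s‖ ≤ K * (t * r) * (t * r) ^ n := fun {K t s} ht hK n => by
    have ht0 : 0 ≤ t := (norm_nonneg _).trans ht
    calc ‖e n s‖ = ‖q s‖ ^ (n + 1) * ‖S (n + 1) s - N ^ (n + 1) * A s‖ := by
          rw [he, norm_mul, norm_pow]
      _ ≤ t ^ (n + 1) * (K * r ^ (n + 1)) :=
          mul_le_mul (pow_le_pow_left₀ (norm_nonneg _) ht _) (hK _) (norm_nonneg _)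
            (by positivity)
      _ = _ := by ring
  refine ⟨fun s => A s * (N * q s), fun s => G 0 s + ∑' n, e n s, hA.mul (hq.const_mul _), ?_, ?_⟩
  · intro s hs
    obtain ⟨t, ht1, ht2⟩ := exists_between ((lt_div_iff₀ hr0).2 hs)
    have ht0 : 0 ≤ t := (norm_nonneg _).trans ht1.le
    have htr : t * r < 1 := (lt_div_iff₀ hr0).1 ht2
    obtain ⟨K, hK⟩ := hSA (‖s‖ + 1)
    have hopen : IsOpen (Metric.ball (0 : ℂ) (‖s‖ + 1) ∩ {w | ‖q w‖ < t}) :=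
      Metric.isOpen_ball.inter (isOpen_lt hq.continuous.norm continuous_const)
    have hon : DifferentiableOn ℂ (fun s => ∑' n, e n s)
        (Metric.ball (0 : ℂ) (‖s‖ + 1) ∩ {w | ‖q w‖ < t}) :=
      Complex.differentiableOn_tsum_of_summable_norm
        ((summable_geometric_of_lt_one (mul_nonneg ht0 hr0.le) htr).mul_left (K * (t * r)))
        (fun n => ((hq.pow (n + 1)).mul
          ((hS (n + 1)).sub (hA.const_mul _))).differentiableOn) hopen
        fun n w hw => hebound (le_of_lt hw.2) (hK w (mem_ball_zero_iff.1 hw.1)) n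
    exact ((hG0 s).add (hon.differentiableAt (hopen.mem_nhds
      ⟨mem_ball_zero_iff.2 (lt_add_one _), ht1⟩))).differentiableWithinAt
  · intro s hs
    obtain ⟨K, hK⟩ := hSA (‖s‖ + 1)
    have hqr : ‖q s‖ * r < 1 :=
      (mul_le_mul_of_nonneg_left (hr1.le.trans hN) (norm_nonneg _)).trans_lt hs
    have hse : Summable fun n => e n s :=
      Summable.of_norm_bounded ((summable_geometric_of_lt_one
        (mul_nonneg (norm_nonneg _) hr0.le) hqr).mul_left (K * (‖q s‖ * r)))
        (hebound le_rfl (hK s (lt_add_one _)))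
    have hNq : ‖(N : ℂ) * q s‖ < 1 := by
      rwa [norm_mul, Complex.norm_real, Real.norm_of_nonneg hN0.le, mul_comm]
    have hgeo := (hasSum_geometric_of_norm_lt_one hNq).mul_left (A s * (N * q s))
    have htot := ((hgeo.add hse.hasSum).tendsto_sum_nat).const_add (G 0 s)
    have hval : G 0 s + (A s * (N * q s) * (1 - N * q s)⁻¹ + ∑' n, e n s) =
        A s * (N * q s) / (1 - N * q s) + (G 0 s + ∑' n, e n s) := by
      rw [div_eq_mul_inv]
      ring
    rw [hval] at htot
    refine htot.congr fun n => ?_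
    induction n with
    | zero => simp
    | succ n ih =>
      rw [Finset.sum_range_succ, ← add_assoc, ih, hG, he]
      congr 1
      ring

end Continuation

/-! ### Comparison with the zeta function -/

section Comparison

open Set Topology

theorem norm_exp_sub_exp_le {z w : ℂ} {M : ℝ} (hz : ‖z‖ ≤ M) (hw : ‖w‖ ≤ M) :
    ‖Complex.exp z - Complex.exp w‖ ≤ Real.exp M * ‖z - w‖ := by
  refine (convex_closedBall (0 : ℂ) M).norm_image_sub_le_of_norm_deriv_le
    (fun x _ => Complex.differentiableAt_exp) (fun x hx => ?_)
    (mem_closedBall_zero_iff.2 hw) (mem_closedBall_zero_iff.2 hz)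
  rw [Complex.deriv_exp, Complex.norm_exp, Real.exp_le_exp]
  exact (Complex.re_le_norm x).trans (mem_closedBall_zero_iff.1 hx)

theorem differentiable_expTerm (φ : ℝ → ℝ) (x : ℝ) :
    Differentiable ℂ fun s => expTerm φ s x := by
  unfold expTerm
  split_ifs <;> fun_prop

theorem differentiable_expDefect (l : ℝ → ℝ) (β : ℝ) (N : ℕ) (x : ℝ) :
    Differentiable ℂ fun s => expDefect l β N s x := by
  unfold expDefect
  fun_prop

theorem differentiable_sum_map {α : Type*} {F : ℂ → α → ℂ}
    (hF : ∀ x, Differentiable ℂ fun s => F s x)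
    (M : Multiset α) : Differentiable ℂ fun s => (M.map (F s)).sum := by
  induction M using Multiset.induction with
  | empty => simp
  | cons x M ih => simpa only [Multiset.map_cons, Multiset.sum_cons] using (hF x).fun_add ih

theorem lipschitzWith_expDefect {l : ℝ → ℝ} {L : NNReal} (hl : LipschitzWith L l) {B : ℝ}
    (hB : ∀ x, |l x| ≤ B) (β : ℝ) (N : ℕ) {s : ℂ} {ρ : NNReal} (hs : ‖s‖ ≤ ρ) :
    LipschitzWith (Real.toNNReal (Real.exp (ρ * B)) * (ρ * L)) (expDefect l β N s) := by
  refine LipschitzWith.of_dist_le_mul fun x y => ?_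
  have hnorm : ‖-(s / 2)‖ ≤ ρ := by
    rw [norm_neg, norm_div, Complex.norm_ofNat]
    linarith [norm_nonneg s]
  have hle : ∀ x, ‖-(s / 2) * (l x : ℂ)‖ ≤ ρ * B := fun x => by
    rw [norm_mul, Complex.norm_real, Real.norm_eq_abs]
    exact mul_le_mul hnorm (hB x) (abs_nonneg _) ρ.2
  rw [dist_eq_norm, expDefect, expDefect, sub_sub_sub_cancel_right]
  refine (norm_exp_sub_exp_le (hle x) (hle y)).trans ?_
  rw [NNReal.coe_mul, Real.coe_toNNReal _ (Real.exp_pos _).le, NNReal.coe_mul, mul_assoc]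
  refine mul_le_mul_of_nonneg_left ?_ (Real.exp_pos _).le
  rw [← mul_sub, norm_mul, ← Complex.ofReal_sub, Complex.norm_real, mul_assoc]
  refine mul_le_mul hnorm ?_ (norm_nonneg _) ρ.2
  rw [← dist_eq_norm]
  exact hl.dist_le_mul x y

theorem norm_expTerm_log_sub_le {lh : ℝ → ℝ} {a K : ℝ} (ha : 0 ≤ a) (hK : 0 ≤ K)
    (hlh : ∀ x ∈ Ioc 0 a, |lh x - Real.log x| ≤ K * x) (s : ℂ) {δ : ℝ} (hδ0 : 0 ≤ δ)
    (hδ : δ ≤ 2) :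
    ∃ D : ℝ, ∀ x ∈ Icc 0 a, ‖expTerm Real.log s x - expTerm lh s x‖ ≤
      D * (expTerm lh ((s.re - δ : ℝ) : ℂ) x).re := by
  refine ⟨Real.exp (‖s‖ * (K * a)) * (‖s‖ * K) * (a ^ (1 - δ / 2) * Real.exp (δ / 2 * (K * a))),
    fun x hx => ?_⟩
  rcases hx.1.eq_or_lt with rfl | hx0
  · simp [expTerm]
  have hd := hlh x ⟨hx0, hx.2⟩
  have hKx : K * x ≤ K * a := mul_le_mul_of_nonneg_left hx.2 hK
  simp only [expTerm, hx0.ne', if_false]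
  have h1 : Complex.exp (-(s / 2) * Real.log x) - Complex.exp (-(s / 2) * lh x) =
      Complex.exp (-(s / 2) * lh x) *
        (Complex.exp (s / 2 * ((lh x - Real.log x : ℝ) : ℂ)) - Complex.exp 0) := by
    rw [mul_sub, ← Complex.exp_add, ← Complex.exp_add]
    congr 2
    · push_cast
      ring
    · ring
  have hhalf : ‖s / 2‖ ≤ ‖s‖ := by
    rw [norm_div, Complex.norm_ofNat]
    linarith [norm_nonneg s]
  have h2 : ‖s / 2 * ((lh x - Real.log x : ℝ) : ℂ)‖ ≤ ‖s‖ * (K * x) := by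
    rw [norm_mul, Complex.norm_real, Real.norm_eq_abs]
    exact mul_le_mul hhalf hd (abs_nonneg _) (norm_nonneg _)
  have h3 := norm_exp_sub_exp_le (h2.trans (mul_le_mul_of_nonneg_left hKx (norm_nonneg s)))
    (w := 0) (by rw [norm_zero]; positivity)
  rw [sub_zero] at h3
  have h4 : x ≤ a ^ (1 - δ / 2) * Real.exp (δ / 2 * (K * a)) * Real.exp (δ / 2 * lh x) := by
    have h5 : x = x ^ (1 - δ / 2) * x ^ (δ / 2) := by
      rw [← Real.rpow_add hx0]
      simp
    have h6 : x ^ (δ / 2) ≤ Real.exp (δ / 2 * (K * a)) * Real.exp (δ / 2 * lh x) := by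
      rw [Real.rpow_def_of_pos hx0, ← Real.exp_add, Real.exp_le_exp, ← mul_add, mul_comm]
      refine mul_le_mul_of_nonneg_left ?_ (by linarith)
      linarith [(abs_le.1 hd).1]
    have h7 : x ^ (1 - δ / 2) ≤ a ^ (1 - δ / 2) :=
      Real.rpow_le_rpow hx0.le hx.2 (by linarith)
    calc x = x ^ (1 - δ / 2) * x ^ (δ / 2) := h5
      _ ≤ a ^ (1 - δ / 2) * (Real.exp (δ / 2 * (K * a)) * Real.exp (δ / 2 * lh x)) :=
          mul_le_mul h7 h6 (by positivity) (by positivity)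
      _ = _ := by ring
  have h8 : (Complex.exp (-(((s.re - δ : ℝ) : ℂ) / 2) * lh x)).re =
      Real.exp (-(s.re / 2) * lh x) * Real.exp (δ / 2 * lh x) := by
    rw [← Real.exp_add, ← Complex.exp_ofReal_re]
    congr 2
    push_cast
    ring
  have h9 : ‖Complex.exp (-(s / 2) * lh x)‖ = Real.exp (-(s.re / 2) * lh x) := by
    rw [Complex.norm_exp, Complex.re_mul_ofReal, Complex.neg_re, Complex.div_ofNat_re]
  rw [h1, norm_mul, h8, h9]
  calc Real.exp (-(s.re / 2) * lh x) * _
      ≤ Real.exp (-(s.re / 2) * lh x) * (Real.exp (‖s‖ * (K * a)) * (‖s‖ * (K * x))) :=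
        mul_le_mul_of_nonneg_left (h3.trans (mul_le_mul_of_nonneg_left h2 (Real.exp_pos _).le))
          (Real.exp_pos _).le
    _ ≤ Real.exp (-(s.re / 2) * lh x) * (Real.exp (‖s‖ * (K * a)) * (‖s‖ * (K *
          (a ^ (1 - δ / 2) * Real.exp (δ / 2 * (K * a)) * Real.exp (δ / 2 * lh x))))) := by
        gcongr
    _ = _ := by ring

theorem norm_sum_map_le_mul_re {α : Type*} {M : Multiset α} {F G : α → ℂ} {D : ℝ}
    (h : ∀ x ∈ M, ‖F x‖ ≤ D * (G x).re) : ‖(M.map F).sum‖ ≤ D * (M.map G).sum.re := by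
  induction M using Multiset.induction with
  | empty => simp
  | cons x M ih =>
    rw [Multiset.map_cons, Multiset.sum_cons, Multiset.map_cons, Multiset.sum_cons,
      Complex.add_re, mul_add]
    exact (norm_add_le _ _).trans (add_le_add (h x (Multiset.mem_cons_self x M))
      (ih fun y hy => h y (Multiset.mem_cons_of_mem hy)))

theorem zetaPartial_eq {R : ℝ[X]} {c a z₀ : ℝ} (h : Admissible R c a) (hz₀ : z₀ ∈ Icc 0 a)
    (n : ℕ) (s : ℂ) :
    zetaPartial R c z₀ n s = Complex.exp (-(s / 2) * Real.log c) ^ n *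
      ((polyIter R n - C z₀).roots.map (expTerm Real.log s)).sum := by
  have hc0 : 0 < c := zero_lt_one.trans h.one_lt
  rw [zetaPartial, preimageRoots_eq_map h.inv n hz₀, Multiset.map_map, ← Multiset.sum_map_mul_left]
  refine congrArg Multiset.sum (Multiset.map_congr rfl fun x hx => ?_)
  have hx0 := (mem_Icc_of_mem_roots h.inv n hz₀ hx).1
  simp only [Function.comp, expTerm, Complex.ofReal_eq_zero]
  split_ifs with h0
  · simp
  have hxp : 0 < x := hx0.lt_of_ne' h0
  rw [← Complex.ofReal_pow, ← Complex.ofReal_mul,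
    Complex.cpow_def_of_ne_zero (Complex.ofReal_ne_zero.2 (by positivity)),
    ← Complex.ofReal_log (by positivity), Real.log_mul (by positivity) hxp.ne', Real.log_pow,
    ← Complex.exp_nat_mul, ← Complex.exp_add]
  congr 1
  push_cast
  ring

end Comparison

section Recurrence

open Set Topology

variable {R : ℝ[X]} {c a : ℝ}

theorem norm_sum_map_sub_card_mul_le {α : Type*} {W : Multiset α} {F : α → ℂ} {A : ℂ} {D : ℝ}
    (h : ∀ w ∈ W, ‖F w - A‖ ≤ D) : ‖(W.map F).sum - W.card * A‖ ≤ W.card * D := by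
  induction W using Multiset.induction with
  | empty => simp
  | cons w W ih =>
    rw [Multiset.map_cons, Multiset.sum_cons, Multiset.card_cons]
    have h1 := norm_add_le (F w - A) ((W.map F).sum - W.card * A)
    have h2 := h w (Multiset.mem_cons_self w W)
    have h3 := ih fun y hy => h y (Multiset.mem_cons_of_mem hy)
    have h4 : F w + (W.map F).sum - ((W.card + 1 : ℕ) : ℂ) * A =
        (F w - A) + ((W.map F).sum - W.card * A) := by
      push_cast
      ring
    rw [h4]
    push_cast
    linarith

theorem Admissible.norm_sum_succ_sub_le (h : Admissible R c a) {n : ℕ} {M : ℝ} (hM : 0 ≤ M)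
    (hE : volume {x : ℝ | x ∈ Icc 0 a ∧ (polyIter R n).eval x ∈ Icc 0 a} ≤ ENNReal.ofReal M)
    {u : ℝ} (hu : u ∈ Icc 0 a) {g : ℝ → ℂ} {L : NNReal} (hg : LipschitzWith L g) :
    ‖((polyIter R (n + 1) - C u).roots.map g).sum -
      R.natDegree * ((polyIter R n - C u).roots.map g).sum‖ ≤ R.natDegree * (2 * (L * M)) := by
  have hdeg : (polyIter R n).natDegree ≠ 0 := by
    rw [natDegree_polyIter]
    exact pow_ne_zero _ h.natDegree_ne_zero
  rw [roots_polyIter_succ' h.inv h.natDegree_ne_zero n hu, Multiset.map_bind, Multiset.sum_bind,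
    ← h.card_roots hu]
  refine norm_sum_map_sub_card_mul_le fun w hw => ?_
  have hwa := h.mem_Icc hu hw
  exact norm_sum_roots_sub_le hdeg hM hwa hu (splits_polyIter_sub_C h.inv n hwa)
    (splits_polyIter_sub_C h.inv n hu) (fun x hx => mem_Icc_of_mem_roots h.inv n hwa hx)
    (fun x hx => mem_Icc_of_mem_roots h.inv n hu hx) hE hg

theorem Admissible.exists_continuation (h : Admissible R c a) {z₀ : ℝ} (hz₀ : z₀ ∈ Icc 0 a)
    {D r : ℝ} (hD : 0 < D) (hr0 : 0 < r) (hr1 : r < 1)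
    (hmeas : ∀ n : ℕ, volume {x : ℝ | x ∈ Icc 0 a ∧ (polyIter R n).eval x ∈ Icc 0 a}
      ≤ ENNReal.ofReal (D * r ^ n)) :
    ∃ ξ ψ : ℂ → ℂ, Differentiable ℂ ξ ∧
      DifferentiableOn ℂ ψ {s | 2 * Real.log r / Real.log c < s.re} ∧
      ∀ s : ℂ, 2 * Real.log R.natDegree / Real.log c < s.re →
        Tendsto (fun n => zetaPartial R c z₀ n s) atTop
          (𝓝 (ξ s / (1 - (R.natDegree : ℂ) * Complex.exp (-(s / 2) * Real.log c)) + ψ s)) := by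
  obtain ⟨lh, l, β, K, B, L, hK, hlh, hl, hB, htrans⟩ := h.exists_transfer
  have ha := h.pos
  have hlogc : 0 < Real.log c := Real.log_pos h.one_lt
  have hN2 := h.two_le
  have hN1 : (1 : ℝ) ≤ R.natDegree := by exact_mod_cast one_le_two.trans hN2
  have hN0 : (0 : ℝ) < R.natDegree := zero_lt_one.trans_le hN1
  set q : ℂ → ℂ := fun s => Complex.exp (-(s / 2) * Real.log c) with hq
  have hqd : Differentiable ℂ q := by fun_prop
  have hqnorm : ∀ s, ‖q s‖ = Real.exp (-(s.re / 2) * Real.log c) := fun s => by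
    simp only [hq]
    rw [Complex.norm_exp, Complex.re_mul_ofReal, Complex.neg_re, Complex.div_ofNat_re]
  have hqlt : ∀ (s : ℂ) {t : ℝ}, 0 < t → (‖q s‖ * t < 1 ↔ 2 * Real.log t / Real.log c < s.re) :=
    fun s t ht => by
      rw [hqnorm, ← Real.exp_log ht, ← Real.exp_add, Real.exp_lt_one_iff, Real.log_exp,
        div_lt_iff₀ hlogc]
      constructor <;> intro hlt <;> linarith
  set S : ℕ → ℂ → ℂ := fun n s =>
    ((polyIter R n - C z₀).roots.map (expDefect l β R.natDegree s)).sum with hS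
  set P : ℕ → ℂ → ℂ := fun n s => ((polyIter R n - C z₀).roots.map (expTerm lh s)).sum with hP
  have hSrec : ∀ ρ : ℝ, ∃ K : ℝ, ∀ s : ℂ, ‖s‖ < ρ → ∀ n,
      ‖S (n + 1) s - (R.natDegree : ℝ) * S n s‖ ≤ K * r ^ n := fun ρ => by
    refine ⟨R.natDegree * (2 * ((Real.toNNReal (Real.exp (ρ.toNNReal * B)) *
      (ρ.toNNReal * L) : NNReal) * D)), fun s hs n => ?_⟩
    have hg := lipschitzWith_expDefect hl hB β R.natDegree (s := s) (ρ := ρ.toNNReal)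
      (hs.le.trans (Real.le_coe_toNNReal ρ))
    refine (h.norm_sum_succ_sub_le (by positivity) (hmeas n) hz₀ hg).trans_eq ?_
    ring
  have hPrec : ∀ n s, q s ^ (n + 1) * P (n + 1) s = q s ^ n * P n s + q s ^ (n + 1) * S (n + 1) s :=
    fun n s => by
      have h1 : q s * Complex.exp (s / 2 * Real.log c) = 1 := by
        rw [hq, ← Complex.exp_add]
        simp
      have h2 : P (n + 1) s = Complex.exp (s / 2 * Real.log c) * P n s + S (n + 1) s := by
        simp only [hP, hS]
        rw [roots_polyIter_succ h.inv h.natDegree_ne_zero n hz₀, Multiset.map_bind,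
          Multiset.sum_bind, Multiset.map_bind, Multiset.sum_bind, ← Multiset.sum_map_mul_left,
          ← Multiset.sum_map_add]
        exact congrArg Multiset.sum (Multiset.map_congr rfl fun y hy =>
          htrans s y (mem_Icc_of_mem_roots h.inv n hz₀ hy))
      rw [h2]
      linear_combination q s ^ n * P n s * h1
  obtain ⟨ξ, ψ, hξ, hψ, hlim⟩ := exists_continuation_of_recurrence (S := S)
    (G := fun n s => q s ^ n * P n s) hN1 hr0 hr1 hqd
    ((hqd.pow 0).mul (differentiable_sum_map (differentiable_expTerm lh) _))
    (fun n => differentiable_sum_map (differentiable_expDefect l β R.natDegree)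
      (polyIter R n - C z₀).roots) hSrec hPrec
  refine ⟨ξ, ψ, hξ, hψ.mono fun s hs => (hqlt s hr0).2 hs, fun s hs => ?_⟩
  have hlims := hlim s ((hqlt s hN0).2 hs)
  rw [Complex.ofReal_natCast] at hlims
  suffices hdiff : Tendsto (fun n => zetaPartial R c z₀ n s - q s ^ n * P n s) atTop (𝓝 0) by
    simpa only [sub_add_cancel, zero_add] using hdiff.add hlims
  obtain ⟨δ, hδ0, hδ2, hδ⟩ : ∃ δ : ℝ, 0 < δ ∧ δ ≤ 2 ∧
      2 * Real.log R.natDegree / Real.log c < s.re - δ := by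
    refine ⟨min 2 ((s.re - 2 * Real.log R.natDegree / Real.log c) / 2),
      lt_min two_pos (by linarith), min_le_left _ _, ?_⟩
    have := min_le_right 2 ((s.re - 2 * Real.log R.natDegree / Real.log c) / 2)
    linarith
  obtain ⟨E, hE⟩ := norm_expTerm_log_sub_le ha.le hK hlh s hδ0.le hδ2
  set τ : ℂ := ((s.re - δ : ℝ) : ℂ) with hτ
  have hτlim := (hlim τ ((hqlt τ hN0).2 (by simpa [hτ] using hδ)))
  have hqs : ‖q s‖ = Real.exp (-(δ / 2) * Real.log c) * ‖q τ‖ := by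
    rw [hqnorm, hqnorm, ← Real.exp_add, hτ, Complex.ofReal_re]
    congr 1
    ring
  have hqτ : q τ = (‖q τ‖ : ℝ) := by
    rw [hqnorm, hτ, Complex.ofReal_re, hq]
    push_cast
    rfl
  have hsmall : Tendsto (fun n : ℕ => Real.exp (-(δ / 2) * Real.log c) ^ n *
      (E * (q τ ^ n * P n τ).re)) atTop (𝓝 0) := by
    have h1 : Real.exp (-(δ / 2) * Real.log c) < 1 := by
      rw [Real.exp_lt_one_iff]
      have := mul_pos hδ0 hlogc
      linarith
    have h2 := (Complex.continuous_re.tendsto _).comp hτlim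
    simpa using (tendsto_pow_atTop_nhds_zero_of_lt_one (Real.exp_pos _).le h1).mul
      (h2.const_mul E)
  refine squeeze_zero_norm (fun n => ?_) hsmall
  rw [zetaPartial_eq h hz₀, ← mul_sub, ← Multiset.sum_map_sub, norm_mul, norm_pow, hqs, mul_pow,
    mul_assoc]
  refine mul_le_mul_of_nonneg_left ?_ (by positivity)
  have h1 : (q τ ^ n * P n τ).re = ‖q τ‖ ^ n * (P n τ).re := by
    conv_lhs => rw [hqτ, ← Complex.ofReal_pow, Complex.re_ofReal_mul]
  rw [h1, mul_left_comm]
  exact mul_le_mul_of_nonneg_left (norm_sum_map_le_mul_re fun x hx =>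
    hE x (mem_Icc_of_mem_roots h.inv n hz₀ hx)) (by positivity)

end Recurrence

end PolynomialZeta

theorem zeta_of_polynomial_continuation_totally_disconnected
    (R : Polynomial ℝ) (N : ℕ) (hN : R.natDegree = N) (hN2 : 2 ≤ N)
    (hR0 : R.eval 0 = 0) (c : ℝ) (hc : R.derivative.eval 0 = c) (hc1 : 1 < c)
    (a : ℝ) (ha : 0 < a)
    (hinv : ∀ z : ℂ, memIcc a (Polynomial.aeval z R) → memIcc a z)
    (z₀ : ℝ) (hz₀ : z₀ ∈ Set.Icc 0 a)
    (C r : ℝ) (hC : 0 < C) (hr0 : 0 < r) (hr1 : r < 1)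
    (hmeas : ∀ n : ℕ,
      volume {x : ℝ | x ∈ Set.Icc 0 a ∧ (polyIter R n).eval x ∈ Set.Icc 0 a}
        ≤ ENNReal.ofReal (C * r ^ n)) :
    ∃ zeta : ℂ → ℂ,
      (∀ s : ℂ, 2 * Real.log N / Real.log c < s.re →
        Filter.Tendsto (fun n => zetaPartial R c z₀ n s) Filter.atTop (nhds (zeta s))) ∧
      ∃ ξ ψ : ℂ → ℂ,
        Differentiable ℂ ξ ∧
        DifferentiableOn ℂ ψ {s : ℂ | 2 * Real.log r / Real.log c < s.re} ∧
        ∀ s : ℂ, 2 * Real.log N / Real.log c < s.re →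
          zeta s = ξ s / (1 - (N : ℂ) * (c : ℂ) ^ (-s / 2)) + ψ s := by
  subst hN
  have h : PolynomialZeta.Admissible R c a := ⟨hN2, hR0, hc, hc1, ha, hinv⟩
  obtain ⟨ξ, ψ, hξ, hψ, hlim⟩ := h.exists_continuation hz₀ hC hr0 hr1 hmeas
  refine ⟨_, hlim, ξ, ψ, hξ, hψ, fun s _ => ?_⟩
  have hc0 : 0 < c := zero_lt_one.trans hc1
  have hpow : (c : ℂ) ^ (-s / 2) = Complex.exp (-(s / 2) * Real.log c) := by
    rw [Complex.cpow_def_of_ne_zero (Complex.ofReal_ne_zero.2 hc0.ne'),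
      ← Complex.ofReal_log hc0.le]
    congr 1
    ring
  rw [hpow]
end

section
/- Let R(z) = 2z(2 − z), so that R(0) = 0 and R'(0) = 4. Then for every complex s with Re(s) > 1, the limit ζ_{0,R}(s) := lim_{n→∞} Σ_{z ∈ R^{-n}{0}, z ≠ 0} (4ⁿ z)^{-s/2} exists and the Riemann zeta function satisfies ζ(s) = (1/2)·(√2·π)^s · ζ_{0,R}(s). -/
open Polynomial Filter

/-- The polynomial `R(z) = 2z(2 - z)`. -/
noncomputable def quadR : Polynomial ℝ :=
  Polynomial.C 2 * Polynomial.X * (Polynomial.C 2 - Polynomial.X)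

theorem polyIter_succ_eq_comp (R : Polynomial ℝ) (n : ℕ) :
    polyIter R (n + 1) = (polyIter R n).comp R := by
  induction n with
  | zero => simp [polyIter]
  | succ n ih =>
    conv_lhs => rw [polyIter, ih, ← Polynomial.comp_assoc, ← polyIter.eq_2]

/-- The points `1 - cos (2πk/2ⁿ)`, written as `2 sin² (πk/2ⁿ)`. -/
noncomputable def quadRoot (n k : ℕ) : ℝ := 2 * Real.sin (Real.pi * k / 2 ^ n) ^ 2

theorem quadRoot_succ_factor (n k : ℕ) :
    quadR - C (quadRoot n k) =
      C (-2) * ((X - C (quadRoot (n + 1) k)) * (X - C (quadRoot (n + 1) (2 ^ n + k)))) := by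
  have h1 : quadRoot (n + 1) (2 ^ n + k) = 2 - quadRoot (n + 1) k := by
    have e : Real.pi * ((2 ^ n + k : ℕ) : ℝ) / 2 ^ (n + 1)
        = Real.pi * k / 2 ^ (n + 1) + Real.pi / 2 := by
      push_cast
      field_simp
      ring
    rw [quadRoot, quadRoot, e, Real.sin_add_pi_div_two, Real.cos_sq']
    ring
  have h2 : quadRoot n k = 2 * quadRoot (n + 1) k * (2 - quadRoot (n + 1) k) := by
    have e : Real.pi * k / 2 ^ n = 2 * (Real.pi * k / 2 ^ (n + 1)) := by
      field_simp
      ring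
    rw [quadRoot, quadRoot, e, Real.sin_two_mul, mul_pow, mul_pow, Real.cos_sq']
    ring
  rw [h1, h2, quadR]
  simp only [C_mul, C_sub, C_neg]
  have : (C 2 : ℝ[X]) = 2 := rfl
  rw [this]
  ring

theorem polyIter_quadR_eq_prod (n : ℕ) :
    ∃ c : ℝ, c ≠ 0 ∧ polyIter quadR n =
      C c * ∏ k ∈ Finset.range (2 ^ n), (X - C (quadRoot n k)) := by
  induction n with
  | zero => exact ⟨1, one_ne_zero, by simp [polyIter, quadRoot]⟩
  | succ n ih =>
    obtain ⟨c, hc, h⟩ := ih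
    refine ⟨c * (-2) ^ (2 ^ n), by positivity, ?_⟩
    rw [polyIter_succ_eq_comp, h, pow_succ 2 n, mul_two, Finset.prod_range_add]
    simp only [mul_comp, C_comp, prod_comp, sub_comp, X_comp, quadRoot_succ_factor,
      Finset.prod_mul_distrib, Finset.prod_const, Finset.card_range, C_mul, C_pow]
    ring

theorem preimageRoots_quadR (n : ℕ) :
    preimageRoots quadR 0 n =
      (Multiset.range (2 ^ n)).map (fun k => ((quadRoot n k : ℝ) : ℂ)) := by
  obtain ⟨c, hc, h⟩ := polyIter_quadR_eq_prod n
  have : (polyIter quadR n - C 0).map (algebraMap ℝ ℂ) =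
      C (c : ℂ) * (((Multiset.range (2 ^ n)).map
        (fun k => ((quadRoot n k : ℝ) : ℂ))).map (fun a => X - C a)).prod := by
    rw [h, Multiset.map_map, C_0, sub_zero, Polynomial.map_mul, Polynomial.map_prod]
    simp [Finset.prod]
  rw [preimageRoots, this, roots_C_mul _ (by exact_mod_cast hc),
    roots_multiset_prod_X_sub_C]

/-- The summand of `zetaPartial quadR 4 0 n s` at the root with index `k`. -/
noncomputable def quadTerm (s : ℂ) (n k : ℕ) : ℂ :=
  if quadRoot n k = 0 then 0 else ((4 ^ n * quadRoot n k : ℝ) : ℂ) ^ (-s / 2)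

theorem zetaPartial_quadR (n : ℕ) (s : ℂ) :
    zetaPartial quadR 4 0 n s = ∑ k ∈ Finset.range (2 ^ n), quadTerm s n k := by
  simp [zetaPartial, preimageRoots_quadR, Multiset.map_map, Finset.sum, quadTerm]

theorem quadRoot_reflect {n j k : ℕ} (h : j + k = 2 ^ n) : quadRoot n j = quadRoot n k := by
  have hj : (j : ℝ) = 2 ^ n - k := by
    rw [eq_sub_iff_add_eq]
    exact_mod_cast h
  have e : Real.pi * (j : ℝ) / 2 ^ n = Real.pi - Real.pi * k / 2 ^ n := by
    rw [hj]
    field_simp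
  rw [quadRoot, e, Real.sin_pi_sub, quadRoot]

theorem zetaPartial_quadR_succ (m : ℕ) (s : ℂ) :
    zetaPartial quadR 4 0 (m + 1) s =
      ∑ k ∈ Finset.range (2 ^ m), quadTerm s (m + 1) (k + 0) +
      ∑ k ∈ Finset.range (2 ^ m), quadTerm s (m + 1) (k + 1) := by
  rw [zetaPartial_quadR, pow_succ, mul_two, Finset.sum_range_add]
  congr 1
  rw [← Finset.sum_range_reflect]
  refine Finset.sum_congr rfl fun k hk => ?_
  rw [Finset.mem_range] at hk
  rw [quadTerm, quadTerm, quadRoot_reflect (k := k + 1)]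
  rw [pow_succ]
  omega

theorem norm_quadTerm_le {s : ℂ} (hs : 1 < s.re) {m k : ℕ} (hk : k ≤ 2 ^ m) :
    ‖quadTerm s (m + 1) k‖ ≤ 1 / (k : ℝ) ^ s.re := by
  rw [quadTerm]
  split_ifs with h
  · rw [norm_zero]
    positivity
  have hk0 : 0 < k := by
    rcases Nat.eq_zero_or_pos k with rfl | h0
    · simp [quadRoot] at h
    · exact h0
  have hkR : (0 : ℝ) < k := by exact_mod_cast hk0
  have hk' : (k : ℝ) ≤ 2 ^ m := by exact_mod_cast hk
  have hle : (k : ℝ) ^ 2 ≤ 4 ^ (m + 1) * quadRoot (m + 1) k := by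
    have hx : Real.pi * k / 2 ^ (m + 1) ≤ Real.pi / 2 := by
      rw [pow_succ, div_le_div_iff₀ (by positivity) (by positivity)]
      nlinarith [mul_le_mul_of_nonneg_left hk' Real.pi_pos.le]
    have hsin := Real.mul_le_sin (x := Real.pi * k / 2 ^ (m + 1)) (by positivity) hx
    have e : 2 / Real.pi * (Real.pi * k / 2 ^ (m + 1)) = k / 2 ^ m := by
      rw [pow_succ]
      field_simp
    rw [e] at hsin
    have hsq := pow_le_pow_left₀ (by positivity) hsin 2
    have h4 : (4 : ℝ) ^ (m + 1) = 4 * (2 ^ m) ^ 2 := by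
      rw [pow_succ, ← pow_mul, mul_comm m 2, pow_mul]
      norm_num
      ring
    rw [div_pow, div_le_iff₀ (by positivity)] at hsq
    rw [quadRoot, h4]
    nlinarith [sq_nonneg (k : ℝ)]
  rw [Complex.norm_cpow_eq_rpow_re_of_pos (lt_of_lt_of_le (by positivity) hle)]
  have hre : (-s / 2).re = -s.re / 2 := by simp
  rw [hre]
  calc (4 ^ (m + 1) * quadRoot (m + 1) k) ^ (-s.re / 2)
      ≤ ((k : ℝ) ^ 2) ^ (-s.re / 2) :=
        Real.rpow_le_rpow_of_nonpos (by positivity) hle (by linarith)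
    _ = 1 / (k : ℝ) ^ s.re := by
        rw [← Real.rpow_natCast, ← Real.rpow_mul hkR.le, one_div, ← Real.rpow_neg hkR.le]
        congr 1
        push_cast
        ring

theorem tendsto_four_pow_mul_quadRoot (k : ℕ) :
    Tendsto (fun n => 4 ^ n * quadRoot n k) atTop
      (nhds ((Real.sqrt 2 * Real.pi * k) ^ 2)) := by
  have hsin : Tendsto (fun n : ℕ => (2 : ℝ) ^ n * Real.sin (Real.pi * k / 2 ^ n)) atTop
      (nhds (Real.pi * k)) := by
    have hd : HasDerivAt (fun t : ℝ => Real.sin (Real.pi * k * t)) (Real.pi * k) 0 := by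
      simpa using ((hasDerivAt_id (0 : ℝ)).const_mul (Real.pi * k)).sin
    have ht : Tendsto (fun n : ℕ => ((1 : ℝ) / 2) ^ n) atTop (nhdsWithin 0 {0}ᶜ) := by
      refine tendsto_nhdsWithin_iff.2
        ⟨tendsto_pow_atTop_nhds_zero_of_lt_one (by norm_num) (by norm_num), ?_⟩
      exact Eventually.of_forall fun n => by simp
    refine (hd.tendsto_slope_zero.comp ht).congr fun n => ?_
    simp [div_eq_mul_inv]
  have := (hsin.pow 2).const_mul 2
  have e : (Real.sqrt 2 * Real.pi * k) ^ 2 = 2 * (Real.pi * k) ^ 2 := by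
    rw [mul_assoc, mul_pow, Real.sq_sqrt (by norm_num)]
  rw [e]
  refine this.congr fun n => ?_
  rw [quadRoot, mul_pow, ← pow_mul, mul_comm n 2, pow_mul]
  norm_num
  ring

theorem Complex.ofReal_sq_cpow_neg_div_two {y : ℝ} (hy : 0 < y) (s : ℂ) :
    ((y ^ 2 : ℝ) : ℂ) ^ (-s / 2) = (y : ℂ) ^ (-s) := by
  have hy' : (y : ℂ) ≠ 0 := by exact_mod_cast hy.ne'
  rw [Complex.cpow_def_of_ne_zero hy',
    Complex.cpow_def_of_ne_zero (by exact_mod_cast (by positivity)),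
    ← Complex.ofReal_log (by positivity), ← Complex.ofReal_log hy.le, Real.log_pow]
  congr 1
  push_cast
  ring

theorem tendsto_quadTerm {s : ℂ} (hs : 1 < s.re) (k : ℕ) :
    Tendsto (fun n => quadTerm s n k) atTop
      (nhds (((Real.sqrt 2 * Real.pi : ℝ) : ℂ) ^ (-s) * (1 / (k : ℂ) ^ s))) := by
  have hs0 : s ≠ 0 := by
    rintro rfl
    simp at hs
    linarith
  rcases Nat.eq_zero_or_pos k with rfl | hk
  · simp [quadTerm, quadRoot, Complex.zero_cpow hs0]
  have hkR : (0 : ℝ) < k := by exact_mod_cast hk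
  have hlim := tendsto_four_pow_mul_quadRoot k
  have hpos : 0 < Real.sqrt 2 * Real.pi * k := by positivity
  have hval : (((Real.sqrt 2 * Real.pi * k) ^ 2 : ℝ) : ℂ) ^ (-s / 2) =
      ((Real.sqrt 2 * Real.pi : ℝ) : ℂ) ^ (-s) * (1 / (k : ℂ) ^ s) := by
    rw [Complex.ofReal_sq_cpow_neg_div_two hpos, Complex.ofReal_mul (Real.sqrt 2 * Real.pi),
      Complex.mul_cpow_ofReal_nonneg (by positivity) hkR.le, Complex.cpow_neg (((k : ℝ)) : ℂ),
      one_div, Complex.ofReal_natCast]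
  rw [← hval]
  have hcont : ContinuousAt (fun x : ℝ => (x : ℂ) ^ (-s / 2))
      ((Real.sqrt 2 * Real.pi * k) ^ 2) :=
    (Complex.continuous_ofReal.continuousAt).cpow continuousAt_const
      (Complex.ofReal_mem_slitPlane.2 (by positivity))
  refine (hcont.tendsto.comp hlim).congr' ?_
  filter_upwards [hlim.eventually_ne (by positivity : (Real.sqrt 2 * Real.pi * k) ^ 2 ≠ 0)]
    with n hn
  rw [quadTerm, if_neg (right_ne_zero_of_mul hn)]
  rfl

theorem tendsto_sum_quadTerm {s : ℂ} (hs : 1 < s.re) {b : ℕ} (hb : b ≤ 1) :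
    Tendsto (fun m => ∑ k ∈ Finset.range (2 ^ m), quadTerm s (m + 1) (k + b)) atTop
      (nhds (((Real.sqrt 2 * Real.pi : ℝ) : ℂ) ^ (-s) * ∑' k : ℕ, 1 / ((k + b : ℕ) : ℂ) ^ s)) := by
  rw [← tsum_mul_left]
  have hsum : Summable fun k : ℕ => 1 / ((k + b : ℕ) : ℝ) ^ s.re :=
    (summable_nat_add_iff b).2 (Real.summable_one_div_nat_rpow.2 hs)
  have := tendsto_tsum_of_dominated_convergence (𝓕 := atTop)
    (f := fun m k => if k ∈ Finset.range (2 ^ m) then quadTerm s (m + 1) (k + b) else 0)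
    hsum (g := fun k => ((Real.sqrt 2 * Real.pi : ℝ) : ℂ) ^ (-s) * (1 / ((k + b : ℕ) : ℂ) ^ s))
    (fun k => by
      refine ((tendsto_quadTerm hs (k + b)).comp (tendsto_add_atTop_nat 1)).congr' ?_
      filter_upwards [eventually_ge_atTop k] with m hm
      rw [if_pos (Finset.mem_range.2 (hm.trans_lt Nat.lt_two_pow_self))]
      rfl)
    (Eventually.of_forall fun m k => by
      split_ifs with h
      · rw [Finset.mem_range] at h
        exact norm_quadTerm_le hs (by omega)
      · rw [norm_zero]
        positivity)
  refine this.congr fun m => ?_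
  rw [tsum_eq_sum (s := Finset.range (2 ^ m)) fun k hk => if_neg hk]
  exact Finset.sum_congr rfl fun k hk => if_pos hk

theorem riemann_zeta_as_zeta_of_quadratic_polynomial :
    ∀ s : ℂ, 1 < s.re →
      ∃ L : ℂ,
        Filter.Tendsto (fun n => zetaPartial quadR 4 0 n s) Filter.atTop (nhds L) ∧
        riemannZeta s = (1 / 2) * ((Real.sqrt 2 * Real.pi : ℝ) : ℂ) ^ s * L := by
  intro s hs
  refine ⟨((Real.sqrt 2 * Real.pi : ℝ) : ℂ) ^ (-s) * riemannZeta s +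
    ((Real.sqrt 2 * Real.pi : ℝ) : ℂ) ^ (-s) * riemannZeta s, ?_, ?_⟩
  · rw [← tendsto_add_atTop_iff_nat 1]
    simp only [zetaPartial_quadR_succ]
    have h0 := tendsto_sum_quadTerm hs zero_le_one
    have h1 := tendsto_sum_quadTerm hs le_rfl
    have z1 : ∑' k : ℕ, 1 / ((k + 1 : ℕ) : ℂ) ^ s = riemannZeta s := by
      rw [zeta_eq_tsum_one_div_nat_add_one_cpow hs]
      push_cast
      rfl
    rw [z1] at h1
    simp only [add_zero, ← zeta_eq_tsum_one_div_nat_cpow hs] at h0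
    exact h0.add h1
  · have hne : ((Real.sqrt 2 * Real.pi : ℝ) : ℂ) ≠ 0 := by
      exact_mod_cast (by positivity : Real.sqrt 2 * Real.pi ≠ 0)
    have hc : ((Real.sqrt 2 * Real.pi : ℝ) : ℂ) ^ s ≠ 0 := by
      simp [Complex.cpow_eq_zero_iff, hne, -Complex.ofReal_mul]
    rw [Complex.cpow_neg]
    field_simp
    ring
end
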